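/- arXiv:0811.1770 — 7 statements merged into one kernel-verified Lean document; each statement's English description precedes it below -/
import Mathlib

section
/- Let W be a symmetric B-DMC with finite output alphabet 𝒴 and let G be a polarizing ℓ×ℓ matrix over GF(2). For each n ≥ 1, let W^{(i)}, i = 1,…,ℓⁿ, be the split channels defined from W and the Kronecker power G^{⊗n}. Then for every δ > 0, the fraction (1/ℓⁿ)·#{ i ∈ {1,…,ℓⁿ} : I(W^{(i)}) ∈ (δ, 1−δ) } tends to 0 as n → ∞. -/
open scoped BigOperators

/-- A binary-input DMC with finite output alphabet `Y`. -/
def IsBDMC {Y : Type} [Fintype Y] (W : ZMod 2 → Y → ℝ) : Prop :=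
  (∀ x y, 0 ≤ W x y) ∧ ∀ x, ∑ y, W x y = 1

/-- Symmetry of a B-DMC. -/
def IsSymmetricBDMC {Y : Type} [Fintype Y] (W : ZMod 2 → Y → ℝ) : Prop :=
  ∃ π : Y → Y, Function.Involutive π ∧ ∀ y, W 1 y = W 0 (π y)

/-- Symmetric mutual information `I(W)` (base-2 logarithm). -/
noncomputable def mutualInfo {Y : Type} [Fintype Y] (W : ZMod 2 → Y → ℝ) : ℝ :=
  ∑ y, ∑ x : ZMod 2,
    (1 / 2) * W x y * Real.logb 2 (W x y / ((1 / 2) * W 0 y + (1 / 2) * W 1 y))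

/-- Bhattacharyya parameter `Z(W)`. -/
noncomputable def bhatt {Y : Type} [Fintype Y] (W : ZMod 2 → Y → ℝ) : ℝ :=
  ∑ y, Real.sqrt (W 0 y * W 1 y)

/-- The split channel `W^{(i)}` (here `i : Fin m` is 0-based). -/
noncomputable def splitChannel {Y : Type} [Fintype Y] {m : ℕ}
    (W : ZMod 2 → Y → ℝ) (G : Matrix (Fin m) (Fin m) (ZMod 2)) (i : Fin m) :
    ZMod 2 → ((Fin m → Y) × (Fin i.val → ZMod 2)) → ℝ :=
  fun ui z =>
    (1 / 2 ^ (m - 1)) *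
      ∑ u ∈ Finset.univ.filter
          (fun u : Fin m → ZMod 2 =>
            u i = ui ∧ ∀ j : Fin i.val, u (Fin.castLE i.isLt.le j) = z.2 j),
        ∏ j, W (Matrix.vecMul u G j) (z.1 j)

/-- The channel `W^k` (k independent uses of `W` with the same input). -/
noncomputable def prodChannel {Y : Type} [Fintype Y] (W : ZMod 2 → Y → ℝ) (k : ℕ) :
    ZMod 2 → (Fin k → Y) → ℝ :=
  fun x y => ∏ j, W x (y j)

def IsUpperTriangular {l : ℕ} (M : Matrix (Fin l) (Fin l) (ZMod 2)) : Prop :=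
  ∀ i j : Fin l, j < i → M i j = 0

/-- `G` is polarizing: invertible and no column permutation is upper triangular. -/
def IsPolarizing {l : ℕ} (G : Matrix (Fin l) (Fin l) (ZMod 2)) : Prop :=
  IsUnit G.det ∧
    ∀ σ : Equiv.Perm (Fin l), ¬ IsUpperTriangular (Matrix.of fun i j => G i (σ j))

/-- `n`-th Kronecker power of `G`, as an `ℓ^n × ℓ^n` matrix. -/
def kronPow {l : ℕ} (G : Matrix (Fin l) (Fin l) (ZMod 2)) :
    (n : ℕ) → Matrix (Fin (l ^ n)) (Fin (l ^ n)) (ZMod 2)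
  | 0 => 1
  | n + 1 =>
      Matrix.reindex (finProdFinEquiv.trans (finCongr (pow_succ' l n).symm))
        (finProdFinEquiv.trans (finCongr (pow_succ' l n).symm))
        (Matrix.kroneckerMap (· * ·) G (kronPow G n))

/-- The contribution of an output symbol with likelihoods `a`, `b` to the symmetric mutual
information, measured in nats. -/
noncomputable def symbolInfo (a b : ℝ) : ℝ :=
  (a * Real.log (a / ((a + b) / 2)) + b * Real.log (b / ((a + b) / 2))) / 2

theorem mul_log_mul (x y : ℝ) :
    x * y * Real.log (x * y) = x * y * Real.log x + x * y * Real.log y := by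
  rcases eq_or_ne x 0 with rfl | hx
  · simp
  rcases eq_or_ne y 0 with rfl | hy
  · simp
  rw [Real.log_mul hx hy]; ring

theorem mul_log_sub_mul_log_div_le {p A r : ℝ} (hp : 0 ≤ p) (hA : 0 ≤ A) (hr : 0 ≤ r)
    (hpA : A = 0 → p = 0) (hpr : r = 0 → p = 0) :
    p * Real.log r - p * Real.log (p / A) ≤ A * r - p := by
  rcases hp.eq_or_lt with rfl | hp
  · simpa using mul_nonneg hA hr
  have hA' : 0 < A := hA.lt_of_ne fun h => hp.ne' (hpA h.symm)
  have hr' : 0 < r := hr.lt_of_ne fun h => hp.ne' (hpr h.symm)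
  have h := Real.log_le_sub_one_of_pos (x := r / (p / A)) (by positivity)
  rw [Real.log_div hr'.ne' (by positivity)] at h
  calc p * Real.log r - p * Real.log (p / A) = p * (Real.log r - Real.log (p / A)) := by ring
    _ ≤ p * (r / (p / A) - 1) := by gcongr
    _ = A * r - p := by field_simp

/-- The log sum inequality for two terms. -/
theorem log_sum_le {p q A C : ℝ} (hp : 0 ≤ p) (hq : 0 ≤ q) (hA : 0 ≤ A) (hC : 0 ≤ C)
    (hpA : A = 0 → p = 0) (hqC : C = 0 → q = 0) :
    (p + q) * Real.log ((p + q) / (A + C)) ≤ p * Real.log (p / A) + q * Real.log (q / C) := by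
  rcases (add_nonneg hA hC).eq_or_lt with h | h
  · have hA0 : A = 0 := by linarith
    have hC0 : C = 0 := by linarith
    simp [hpA hA0, hqC hC0]
  have hr : 0 ≤ (p + q) / (A + C) := by positivity
  have h0 : (p + q) / (A + C) = 0 → p + q = 0 := fun h' => by
    rcases div_eq_zero_iff.1 h' with h' | h' <;> linarith
  have h1 := mul_log_sub_mul_log_div_le hp hA hr hpA fun h' => by linarith [h0 h']
  have h2 := mul_log_sub_mul_log_div_le hq hC hr hqC fun h' => by linarith [h0 h']
  have h3 : A * ((p + q) / (A + C)) + C * ((p + q) / (A + C)) = p + q := by field_simp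
  linarith

theorem symbolInfo_comm (a b : ℝ) : symbolInfo a b = symbolInfo b a := by
  simp only [symbolInfo, add_comm]

@[simp] theorem symbolInfo_zero : symbolInfo 0 0 = 0 := by simp [symbolInfo]

theorem symbolInfo_eq {a b : ℝ} (ha : 0 ≤ a) (hb : 0 ≤ b) :
    symbolInfo a b = (a * Real.log a + b * Real.log b - (a + b) * Real.log (a + b)
      + (a + b) * Real.log 2) / 2 := by
  have key : ∀ x s : ℝ, (s = 0 → x = 0) →
      x * Real.log (x / (s / 2)) = x * Real.log x - x * Real.log s + x * Real.log 2 := by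
    intro x s hs
    rcases eq_or_ne x 0 with rfl | hx
    · simp
    have hs' : s ≠ 0 := fun h => hx (hs h)
    rw [Real.log_div hx (by positivity), Real.log_div hs' (by norm_num)]; ring
  rw [symbolInfo, key a (a + b) (fun h => by linarith), key b (a + b) (fun h => by linarith)]
  ring

theorem symbolInfo_mul {c : ℝ} (a b : ℝ) :
    symbolInfo (c * a) (c * b) = c * symbolInfo a b := by
  rcases eq_or_ne c 0 with rfl | hc
  · simp
  have h : ∀ x, c * x / ((c * a + c * b) / 2) = x / ((a + b) / 2) := fun x => by
    rw [← mul_add, mul_div_assoc c (a + b) 2, mul_div_mul_left _ _ hc]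
  simp only [symbolInfo, h]; ring

theorem symbolInfo_add_le {a b a' b' : ℝ} (ha : 0 ≤ a) (hb : 0 ≤ b) (ha' : 0 ≤ a')
    (hb' : 0 ≤ b') :
    symbolInfo (a + a') (b + b') ≤ symbolInfo a b + symbolInfo a' b' := by
  have h1 := log_sum_le ha ha' (A := (a + b) / 2) (C := (a' + b') / 2) (by positivity)
    (by positivity) (fun h => by linarith) (fun h => by linarith)
  have h2 := log_sum_le hb hb' (A := (a + b) / 2) (C := (a' + b') / 2) (by positivity)
    (by positivity) (fun h => by linarith) (fun h => by linarith)
  have h3 : (a + b) / 2 + (a' + b') / 2 = (a + a' + (b + b')) / 2 := by ring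
  rw [h3] at h1 h2
  simp only [symbolInfo]
  linarith

theorem symbolInfo_sum_le {ι : Type*} (s : Finset ι) {f g : ι → ℝ} (hf : ∀ i, 0 ≤ f i)
    (hg : ∀ i, 0 ≤ g i) :
    symbolInfo (∑ i ∈ s, f i) (∑ i ∈ s, g i) ≤ ∑ i ∈ s, symbolInfo (f i) (g i) := by
  classical
  induction s using Finset.induction_on with
  | empty => simp
  | insert i s hi ih =>
    rw [Finset.sum_insert hi, Finset.sum_insert hi, Finset.sum_insert hi]
    exact (symbolInfo_add_le (hf i) (hg i) (Finset.sum_nonneg fun i _ => hf i)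
      (Finset.sum_nonneg fun i _ => hg i)).trans (by gcongr)

theorem symbolInfo_nonneg {a b : ℝ} (ha : 0 ≤ a) (hb : 0 ≤ b) : 0 ≤ symbolInfo a b := by
  have h := symbolInfo_add_le ha hb hb ha
  have h2 : symbolInfo (a + b) (b + a) = 0 := by
    rw [symbolInfo_eq (by positivity) (by positivity)]
    rw [show a + b + (b + a) = 2 * (a + b) by ring, mul_log_mul, add_comm b a]
    ring
  rw [symbolInfo_comm b a] at h
  linarith

/-- An upper bound for the conditional entropy `(a + b) / 2 * log 2 - symbolInfo a b`. -/
theorem le_symbolInfo_add {a b t : ℝ} (ha : 0 ≤ a) (hb : 0 ≤ b) (ht : 0 < t) :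
    (a + b) / 2 * Real.log 2 ≤
      symbolInfo a b + t * ((a + b) / 2) + min a b * (-Real.log t / 2) := by
  wlog hab : a ≤ b generalizing a b
  · have := this hb ha (by linarith)
    rwa [symbolInfo_comm, min_comm, add_comm b a] at this
  rw [min_eq_left hab]
  rcases ha.eq_or_lt with rfl | ha
  · rw [symbolInfo_eq le_rfl hb]
    have : 0 ≤ t * (b / 2) := by positivity
    simp; linarith
  have hb : 0 < b := by linarith
  rw [symbolInfo_eq ha.le hb.le]
  have h1 := Real.log_le_sub_one_of_pos (x := t * ((a + b) / a)) (by positivity)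
  rw [Real.log_mul ht.ne' (by positivity), Real.log_div (by positivity) ha.ne'] at h1
  have h2 := Real.log_le_sub_one_of_pos (x := (a + b) / b) (by positivity)
  rw [Real.log_div (by positivity) hb.ne'] at h2
  have h1' := mul_le_mul_of_nonneg_left h1 ha.le
  have h2' := mul_le_mul_of_nonneg_left h2 hb.le
  have e1 : a * (t * ((a + b) / a) - 1) = t * (a + b) - a := by field_simp
  have e2 : b * ((a + b) / b - 1) = a := by field_simp; ring
  rw [e1] at h1'
  rw [e2] at h2'
  linarith

theorem symbolInfo_le {a b : ℝ} (ha : 0 ≤ a) (hb : 0 ≤ b) :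
    symbolInfo a b ≤ (a + b) / 2 * Real.log 2 := by
  have key : ∀ x y : ℝ, 0 ≤ x → 0 ≤ y → x * Real.log x ≤ x * Real.log (x + y) := by
    intro x y hx hy
    rcases hx.eq_or_lt with rfl | hx
    · simp
    · gcongr; linarith
  have h1 := key a b ha hb
  have h2 := key b a hb ha
  rw [add_comm b a] at h2
  rw [symbolInfo_eq ha hb]
  linarith

theorem symbolInfo_mul_mul_ge {a b s t : ℝ} (ha : 0 ≤ a) (hab : a ≤ b) (hs : 0 ≤ s)
    (ht : 0 ≤ t) :
    a * symbolInfo s t + (s * (a * Real.log a) + t * (b * Real.log b)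
      - (a * s + b * t) * Real.log (a + b) + (a * s + b * t) * Real.log 2) / 2
      ≤ symbolInfo (a * s) (b * t) := by
  have hb : 0 ≤ b := ha.trans hab
  have h := log_sum_le (p := a * (s + t)) (q := (b - a) * t) (A := 2 * a) (C := b - a)
    (by positivity) (mul_nonneg (by linarith) ht) (by positivity) (by linarith)
    (fun h => by simp [show a = 0 by linarith]) (fun h => by simp [h])
  have h1 : a * (s + t) + (b - a) * t = a * s + b * t := by ring
  have h2 : 2 * a + (b - a) = a + b := by ring
  rw [h1, h2] at h
  have e1 : (a * s + b * t) * Real.log ((a * s + b * t) / (a + b))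
      = (a * s + b * t) * Real.log (a * s + b * t) - (a * s + b * t) * Real.log (a + b) := by
    rcases eq_or_ne (a * s + b * t) 0 with h0 | h0
    · simp [h0]
    rcases (add_nonneg ha hb).eq_or_lt with h3 | h3
    · exact absurd (by simp [show a = 0 by linarith, show b = 0 by linarith]) h0
    rw [Real.log_div h0 h3.ne']; ring
  have e2 : a * (s + t) * Real.log (a * (s + t) / (2 * a))
      = a * ((s + t) * Real.log (s + t)) - a * (s + t) * Real.log 2 := by
    rcases eq_or_ne a 0 with rfl | h0
    · simp
    rcases eq_or_ne (s + t) 0 with h3 | h3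
    · simp [h3]
    rw [mul_comm 2 a, mul_div_mul_left _ _ h0, Real.log_div h3 (by norm_num)]; ring
  have e3 : (b - a) * t * Real.log ((b - a) * t / (b - a)) = (b - a) * (t * Real.log t) := by
    rcases eq_or_ne (b - a) 0 with h0 | h0
    · simp [h0]
    rw [mul_div_cancel_left₀ _ h0]; ring
  rw [e1, e2, e3] at h
  rw [symbolInfo_eq hs ht, symbolInfo_eq (by positivity) (by positivity), mul_log_mul a s,
    mul_log_mul b t]
  linarith

theorem le_sum_symbolInfo_mul {Z : Type*} [Fintype Z] {s t : Z → ℝ} (hs : ∀ z, 0 ≤ s z)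
    (ht : ∀ z, 0 ≤ t z) (hs1 : ∑ z, s z = 1) (ht1 : ∑ z, t z = 1) {a b : ℝ} (ha : 0 ≤ a)
    (hb : 0 ≤ b) :
    symbolInfo a b + min a b * ∑ z, symbolInfo (s z) (t z)
      ≤ ∑ z, symbolInfo (a * s z) (b * t z) := by
  wlog hab : a ≤ b generalizing a b s t
  · have := this ht hs ht1 hs1 hb ha (by linarith)
    simpa only [symbolInfo_comm, min_comm] using this
  refine le_trans (le_of_eq ?_)
    (Finset.sum_le_sum fun z _ => symbolInfo_mul_mul_ge ha hab (hs z) (ht z))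
  rw [min_eq_left hab, symbolInfo_eq ha hb]
  simp only [Finset.sum_add_distrib, ← Finset.sum_div, Finset.sum_sub_distrib, ← Finset.sum_mul,
    ← Finset.mul_sum, hs1, ht1]
  ring

/-- The symmetric mutual information of a channel, measured in nats. -/
noncomputable def channelInfo {Y : Type} [Fintype Y] (W : ZMod 2 → Y → ℝ) : ℝ :=
  ∑ y, symbolInfo (W 0 y) (W 1 y)

theorem sum_zmod_two (f : ZMod 2 → ℝ) : ∑ x, f x = f 0 + f 1 :=
  Fin.sum_univ_two f

theorem mutualInfo_eq {Y : Type} [Fintype Y] (W : ZMod 2 → Y → ℝ) :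
    mutualInfo W = channelInfo W / Real.log 2 := by
  rw [mutualInfo, channelInfo, Finset.sum_div]
  refine Finset.sum_congr rfl fun y _ => ?_
  rw [sum_zmod_two, symbolInfo, ← mul_add, one_div_mul_eq_div]
  simp only [Real.logb]
  ring_nf

theorem channelInfo_nonneg {Y : Type} [Fintype Y] {W : ZMod 2 → Y → ℝ} (hW : IsBDMC W) :
    0 ≤ channelInfo W :=
  Finset.sum_nonneg fun y _ => symbolInfo_nonneg (hW.1 0 y) (hW.1 1 y)

theorem channelInfo_le {Y : Type} [Fintype Y] {W : ZMod 2 → Y → ℝ} (hW : IsBDMC W) :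
    channelInfo W ≤ Real.log 2 := by
  refine (Finset.sum_le_sum fun y _ => symbolInfo_le (hW.1 0 y) (hW.1 1 y)).trans (le_of_eq ?_)
  rw [← Finset.sum_mul, ← Finset.sum_div, Finset.sum_add_distrib, hW.2, hW.2]
  ring

/-- The overlap of the two conditional output distributions of a channel. -/
noncomputable def overlap {Y : Type} [Fintype Y] (W : ZMod 2 → Y → ℝ) : ℝ :=
  ∑ y, min (W 0 y) (W 1 y)

theorem log_two_le_channelInfo_add {Y : Type} [Fintype Y] {W : ZMod 2 → Y → ℝ} (hW : IsBDMC W)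
    {t : ℝ} (ht : 0 < t) :
    Real.log 2 ≤ channelInfo W + t + overlap W * (-Real.log t / 2) := by
  have h := Finset.sum_le_sum fun y (_ : y ∈ Finset.univ) =>
    le_symbolInfo_add (hW.1 0 y) (hW.1 1 y) ht
  simp only [Finset.sum_add_distrib, ← Finset.sum_mul, ← Finset.mul_sum, ← Finset.sum_div,
    hW.2] at h
  norm_num at h
  exact h

theorem ZMod.eq_zero_or_one (a : ZMod 2) : a = 0 ∨ a = 1 := by
  revert a; decide

theorem channelInfo_shift {Y : Type} [Fintype Y] (W : ZMod 2 → Y → ℝ) (a : ZMod 2) :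
    channelInfo (fun x => W (x + a)) = channelInfo W := by
  rcases ZMod.eq_zero_or_one a with rfl | rfl
  · simp
  · simp only [channelInfo, zero_add, CharTwo.add_self_eq_zero]
    exact Finset.sum_congr rfl fun y _ => symbolInfo_comm _ _

theorem overlap_shift {Y : Type} [Fintype Y] (W : ZMod 2 → Y → ℝ) (a : ZMod 2) :
    overlap (fun x => W (x + a)) = overlap W := by
  rcases ZMod.eq_zero_or_one a with rfl | rfl
  · simp
  · simp only [overlap, zero_add, CharTwo.add_self_eq_zero]
    exact Finset.sum_congr rfl fun y _ => min_comm _ _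

theorem IsBDMC.shift {Y : Type} [Fintype Y] {W : ZMod 2 → Y → ℝ} (hW : IsBDMC W) (a : ZMod 2) :
    IsBDMC (fun x => W (x + a)) :=
  ⟨fun x => hW.1 (x + a), fun x => hW.2 (x + a)⟩

theorem channelInfo_add_le_two_uses {Y Z : Type} [Fintype Y] [Fintype Z] {V : ZMod 2 → Y → ℝ}
    {W : ZMod 2 → Z → ℝ} (hV : IsBDMC V) (hW : IsBDMC W) :
    channelInfo V + overlap V * channelInfo W ≤
      ∑ p : Y × Z, symbolInfo (V 0 p.1 * W 0 p.2) (V 1 p.1 * W 1 p.2) := by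
  rw [Fintype.sum_prod_type]
  refine le_trans (le_of_eq ?_) (Finset.sum_le_sum fun y _ => le_sum_symbolInfo_mul
    (hW.1 0) (hW.1 1) (hW.2 0) (hW.2 1) (hV.1 0 y) (hV.1 1 y))
  rw [Finset.sum_add_distrib, ← Finset.sum_mul]
  rfl

theorem sum_prod_eq_one {m : ℕ} {Y : Type} [Fintype Y] {f : Fin m → Y → ℝ}
    (hf : ∀ j, ∑ y, f j y = 1) : ∑ y : Fin m → Y, ∏ j, f j (y j) = 1 := by
  classical
  rw [← Fintype.piFinset_univ, Finset.sum_prod_piFinset]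
  simp [hf]

theorem sum_prod_filter_eq_mul {m : ℕ} {Y : Type} [Fintype Y] [DecidableEq Y]
    {f : Fin m → Y → ℝ} (hf : ∀ j, ∑ y, f j y = 1) {j k : Fin m} (hjk : j ≠ k) (p : Y × Y) :
    ∑ y : Fin m → Y with (y j, y k) = p, ∏ i, f i (y i) = f j p.1 * f k p.2 := by
  have h : ({y : Fin m → Y | (y j, y k) = p} : Finset _) = Fintype.piFinset
      fun i => if i = j then {p.1} else if i = k then {p.2} else Finset.univ := by
    ext y
    simp only [Finset.mem_filter, Finset.mem_univ, true_and, Fintype.mem_piFinset]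
    constructor
    · rintro rfl i
      split_ifs with h1 h2
      · simp [h1]
      · simp [h2]
      · simp
    · intro h
      have h1 := h j
      have h2 := h k
      simp [hjk.symm] at h1 h2
      ext <;> simp [h1, h2]
  rw [h, ← Finset.prod_univ_sum, Finset.prod_eq_mul j k hjk]
  · simp [hjk.symm]
  · intro i _ hi
    simp [hi.1, hi.2, hf]
  · simp
  · simp

section SplitChannel

variable {m : ℕ}

/-- The first `i` entries of a vector. -/
def initial (i : Fin m) (u : Fin m → ZMod 2) : Fin i.val → ZMod 2 :=
  fun j => u (Fin.castLE i.isLt.le j)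

theorem splitChannel_eq {Y : Type} [Fintype Y] (W : ZMod 2 → Y → ℝ)
    (G : Matrix (Fin m) (Fin m) (ZMod 2)) (i : Fin m) (x : ZMod 2) (y : Fin m → Y)
    (w : Fin i.val → ZMod 2) :
    splitChannel W G i x (y, w) = 1 / 2 ^ (m - 1) *
      ∑ u : Fin m → ZMod 2 with u i = x ∧ initial i u = w, ∏ j, W (Matrix.vecMul u G j) (y j) := by
  simp only [splitChannel, initial, funext_iff]

theorem card_filter_apply_eq (i : Fin m) (x : ZMod 2) :
    ({u : Fin m → ZMod 2 | u i = x} : Finset _).card = 2 ^ (m - 1) := by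
  have h : ({u : Fin m → ZMod 2 | u i = x} : Finset _) = Fintype.piFinset
      fun j => if j = i then {x} else Finset.univ := by
    ext u
    simp only [Finset.mem_filter, Finset.mem_univ, true_and, Fintype.mem_piFinset]
    constructor
    · rintro rfl j
      split_ifs with h
      · simp [h]
      · simp
    · intro h
      simpa using h i
  rw [h, Fintype.card_piFinset]
  simp [apply_ite, Finset.prod_ite, Finset.filter_ne', ZMod.card]

/-- The probability of `w` as a value of the past inputs of the `i`-th split channel. -/
noncomputable def pastWeight (i : Fin m) (x : ZMod 2) (w : Fin i.val → ZMod 2) : ℝ :=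
  1 / 2 ^ (m - 1) * ({u : Fin m → ZMod 2 | u i = x ∧ initial i u = w} : Finset _).card

theorem sum_pastWeight (i : Fin m) (x : ZMod 2) : ∑ w, pastWeight i x w = 1 := by
  have h := Finset.card_eq_sum_card_fiberwise (f := initial i)
    (s := {u : Fin m → ZMod 2 | u i = x}) (t := Finset.univ) (fun _ _ => by simp)
  rw [card_filter_apply_eq] at h
  simp only [Finset.filter_filter] at h
  simp only [pastWeight, ← Finset.mul_sum, ← Nat.cast_sum, ← h]
  simp

theorem initial_add_single (i : Fin m) (u : Fin m → ZMod 2) (a : ZMod 2) :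
    initial i (u + Pi.single i a) = initial i u := by
  funext j
  have : Fin.castLE i.isLt.le j ≠ i := by
    intro h
    have := congrArg Fin.val h
    simp at this
    omega
  simp [initial, this]

theorem pastWeight_one (i : Fin m) (w : Fin i.val → ZMod 2) :
    pastWeight i 1 w = pastWeight i 0 w := by
  unfold pastWeight
  congr 2
  refine Finset.card_equiv (Equiv.addRight (Pi.single i 1)) fun u => ?_
  have h : ∀ a : ZMod 2, a = 1 ↔ a + 1 = 0 := by decide
  simp [initial_add_single, ← h]

theorem pastWeight_nonneg (i : Fin m) (x : ZMod 2) (w : Fin i.val → ZMod 2) :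
    0 ≤ pastWeight i x w := by
  unfold pastWeight; positivity

theorem IsBDMC.splitChannel {Y : Type} [Fintype Y] {W : ZMod 2 → Y → ℝ} (hW : IsBDMC W)
    (G : Matrix (Fin m) (Fin m) (ZMod 2)) (i : Fin m) : IsBDMC (splitChannel W G i) := by
  refine ⟨fun x z => mul_nonneg (by positivity)
    (Finset.sum_nonneg fun u _ => Finset.prod_nonneg fun j _ => hW.1 _ _), fun x => ?_⟩
  rw [Fintype.sum_prod_type_right, ← sum_pastWeight i x]
  refine Finset.sum_congr rfl fun w _ => ?_
  simp only [splitChannel_eq, ← Finset.mul_sum]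
  rw [Finset.sum_comm, Finset.sum_congr rfl fun u _ =>
    sum_prod_eq_one (f := fun j => W (Matrix.vecMul u G j)) fun j => hW.2 _]
  simp [pastWeight]

theorem exists_vecMul_eq {G : Matrix (Fin m) (Fin m) (ZMod 2)} {i j : Fin m} (hij : G i j = 1)
    (h : ∀ i', i < i' → G i' j = 0) (w : Fin i.val → ZMod 2) :
    ∃ a, ∀ u, initial i u = w → Matrix.vecMul u G j = u i + a := by
  refine ⟨∑ i' : Fin m, if h : i' < i then w ⟨i', h⟩ * G i' j else 0, ?_⟩
  rintro u rfl
  rw [← Fintype.sum_ite_eq i (fun _ => u i), ← Finset.sum_add_distrib, Matrix.vecMul, dotProduct]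
  refine Finset.sum_congr rfl fun i' _ => ?_
  rcases lt_trichotomy i' i with h1 | rfl | h1
  · simp [h1, h1.ne', initial]
  · simp [hij]
  · simp [h i' h1, h1.ne]

theorem channelInfo_add_le_splitChannel {Y : Type} [Fintype Y] {W : ZMod 2 → Y → ℝ}
    (hW : IsBDMC W) {G : Matrix (Fin m) (Fin m) (ZMod 2)} {i j k : Fin m} (hjk : j ≠ k)
    (hij : G i j = 1) (hik : G i k = 1) (hj : ∀ i', i < i' → G i' j = 0)
    (hk : ∀ i', i < i' → G i' k = 0) :
    channelInfo W + overlap W * channelInfo W ≤ channelInfo (splitChannel W G i) := by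
  classical
  have hS := hW.splitChannel G i
  rw [← one_mul (_ + _), ← sum_pastWeight i 0, Finset.sum_mul, channelInfo.eq_1 (splitChannel W G i),
    Fintype.sum_prod_type_right]
  refine Finset.sum_le_sum fun w _ => ?_
  obtain ⟨a, ha⟩ := exists_vecMul_eq hij hj w
  obtain ⟨b, hb⟩ := exists_vecMul_eq hik hk w
  have key : ∀ (p : Y × Y) (x : ZMod 2),
      ∑ y : Fin m → Y with (y j, y k) = p, splitChannel W G i x (y, w) =
        pastWeight i 0 w * (W (x + a) p.1 * W (x + b) p.2) := by
    intro p x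
    have hx : pastWeight i 0 w = pastWeight i x w := by
      rcases ZMod.eq_zero_or_one x with rfl | rfl
      · rfl
      · exact (pastWeight_one i w).symm
    simp only [splitChannel_eq, ← Finset.mul_sum]
    rw [Finset.sum_comm, Finset.sum_congr rfl fun u _ => sum_prod_filter_eq_mul
      (f := fun j => W (Matrix.vecMul u G j)) (fun j => hW.2 _) hjk p,
      Finset.sum_congr rfl (g := fun _ => W (x + a) p.1 * W (x + b) p.2)]
    · rw [hx, pastWeight, Finset.sum_const, nsmul_eq_mul, mul_assoc]
    · intro u hu
      simp only [Finset.mem_filter, Finset.mem_univ, true_and] at hu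
      simp only [ha u hu.2, hb u hu.2, hu.1]
  calc pastWeight i 0 w * (channelInfo W + overlap W * channelInfo W)
      ≤ pastWeight i 0 w * ∑ p : Y × Y, symbolInfo (W (0 + a) p.1 * W (0 + b) p.2)
          (W (1 + a) p.1 * W (1 + b) p.2) := by
        have := channelInfo_add_le_two_uses (hW.shift a) (hW.shift b)
        rw [channelInfo_shift, channelInfo_shift, overlap_shift] at this
        exact mul_le_mul_of_nonneg_left this (pastWeight_nonneg i 0 w)
    _ = ∑ p : Y × Y, symbolInfo
          (∑ y : Fin m → Y with (y j, y k) = p, splitChannel W G i 0 (y, w))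
          (∑ y : Fin m → Y with (y j, y k) = p, splitChannel W G i 1 (y, w)) := by
        simp only [key, symbolInfo_mul, ← Finset.mul_sum]
    _ ≤ ∑ p : Y × Y, ∑ y : Fin m → Y with (y j, y k) = p,
          symbolInfo (splitChannel W G i 0 (y, w)) (splitChannel W G i 1 (y, w)) :=
        Finset.sum_le_sum fun p _ => symbolInfo_sum_le _ (fun y => hS.1 0 _) fun y => hS.1 1 _
    _ = _ := Finset.sum_fiberwise _ _ _

end SplitChannel

theorem IsPolarizing.exists_two_columns {l : ℕ} {G : Matrix (Fin l) (Fin l) (ZMod 2)}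
    (hG : IsPolarizing G) : ∃ i j k, j ≠ k ∧ G i j = 1 ∧ G i k = 1 ∧
      (∀ i', i < i' → G i' j = 0) ∧ ∀ i', i < i' → G i' k = 0 := by
  have hlast : ∀ j, ∃ i, G i j = 1 ∧ ∀ i', i < i' → G i' j = 0 := by
    intro j
    have hne : ({i | G i j ≠ 0} : Finset (Fin l)).Nonempty := by
      by_contra h
      rw [Finset.not_nonempty_iff_eq_empty, Finset.filter_eq_empty_iff] at h
      exact hG.1.ne_zero (Matrix.det_eq_zero_of_column_eq_zero j fun i => by
        simpa using h (Finset.mem_univ i))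
    refine ⟨_, (ZMod.eq_zero_or_one _).resolve_left
      (Finset.mem_filter.1 (Finset.max'_mem _ hne)).2, fun i' hi' => ?_⟩
    by_contra h
    exact absurd (Finset.le_max' _ i' (by simpa using h)) (not_le.2 hi')
  choose last h1 h2 using hlast
  by_contra! hcon
  have hinj : Function.Injective last := by
    intro j k hjk
    by_contra hne
    obtain ⟨i', hi', h⟩ := hcon (last j) j k hne (h1 j) (hjk ▸ h1 k) (h2 j)
    exact h (h2 k i' (hjk ▸ hi'))
  let σ := Equiv.ofBijective last (Finite.injective_iff_bijective.1 hinj)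
  refine hG.2 σ.symm fun i j hji => h2 _ _ ?_
  rwa [show last (σ.symm j) = j from σ.apply_symm_apply j]

theorem sum_mul_log_prod {m : ℕ} {Z : Type} [Fintype Z] {q : Z → ℝ} (hq : ∑ z, q z = 1) :
    ∑ z : Fin m → Z, (∏ j, q (z j)) * Real.log (∏ j, q (z j)) =
      m * ∑ z, q z * Real.log (q z) := by
  classical
  have h1 : ∀ z : Fin m → Z, (∏ j, q (z j)) * Real.log (∏ j, q (z j)) =
      ∑ k, ∏ j, if j = k then q (z j) * Real.log (q (z j)) else q (z j) := by
    intro z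
    have h2 : ∀ k, (∏ j, if j = k then q (z j) * Real.log (q (z j)) else q (z j)) =
        (∏ j, q (z j)) * Real.log (q (z k)) := by
      intro k
      rw [← Finset.mul_prod_erase _ _ (Finset.mem_univ k),
        ← Finset.mul_prod_erase _ (fun j => q (z j)) (Finset.mem_univ k), if_pos rfl,
        Finset.prod_congr rfl fun j hj => if_neg (Finset.ne_of_mem_erase hj)]
      ring
    simp only [h2, ← Finset.mul_sum]
    by_cases h : ∃ j, q (z j) = 0
    · obtain ⟨j, hj⟩ := h
      have h0 : ∏ j, q (z j) = 0 := Finset.prod_eq_zero (Finset.mem_univ j) hj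
      simp only [h0, zero_mul]
    · push Not at h
      rw [Real.log_prod fun j _ => h j]
  simp only [h1]
  rw [Finset.sum_comm]
  have h3 : ∀ k : Fin m, ∑ z : Fin m → Z,
      (∏ j, if j = k then q (z j) * Real.log (q (z j)) else q (z j)) =
        ∑ z, q z * Real.log (q z) := by
    intro k
    rw [← Fintype.piFinset_univ, Finset.sum_prod_piFinset Finset.univ
      fun j z => if j = k then q z * Real.log (q z) else q z,
      ← Finset.mul_prod_erase _ _ (Finset.mem_univ k), Finset.prod_eq_one]
    · simp
    · intro j hj
      simp [Finset.ne_of_mem_erase hj, hq]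
  simp [h3]

section Conservation

variable {m : ℕ}

/-- The first `k` entries of a vector, padded with zeros. -/
def truncate (k : ℕ) (u : Fin m → ZMod 2) : Fin k → ZMod 2 :=
  fun j => if h : j.val < m then u ⟨j, h⟩ else 0

theorem truncate_succ_eq_snoc_iff (i : Fin m) (u : Fin m → ZMod 2) (w : Fin i.val → ZMod 2)
    (x : ZMod 2) :
    truncate (i.val + 1) u = Fin.snoc w x ↔ u i = x ∧ truncate i.val u = w := by
  constructor
  · intro h
    refine ⟨?_, funext fun j => ?_⟩
    · have := congrFun h (Fin.last _)
      simpa [truncate] using this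
    · have := congrFun h j.castSucc
      simpa [truncate] using this
  · rintro ⟨rfl, rfl⟩
    funext j
    refine Fin.lastCases ?_ (fun j => ?_) j
    · simp [truncate]
    · simp [truncate]

theorem initial_eq_truncate (i : Fin m) (u : Fin m → ZMod 2) :
    initial i u = truncate i.val u := by
  funext j
  simp [initial, truncate, j.2.trans i.2]
  rfl

variable {Y : Type}

/-- The joint probability of the outputs `y` and the first `k` inputs `w`. -/
noncomputable def jointProb (W : ZMod 2 → Y → ℝ) (G : Matrix (Fin m) (Fin m) (ZMod 2)) (k : ℕ)
    (y : Fin m → Y) (w : Fin k → ZMod 2) : ℝ :=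
  ∑ u : Fin m → ZMod 2 with truncate k u = w, ∏ j, W (Matrix.vecMul u G j) (y j) / 2

theorem jointProb_eq_add (W : ZMod 2 → Y → ℝ) (G : Matrix (Fin m) (Fin m) (ZMod 2)) (i : Fin m)
    (y : Fin m → Y) (w : Fin i.val → ZMod 2) :
    jointProb W G i.val y w = jointProb W G (i.val + 1) y (Fin.snoc w 0) +
      jointProb W G (i.val + 1) y (Fin.snoc w 1) := by
  simp only [jointProb, truncate_succ_eq_snoc_iff]
  rw [← Finset.sum_fiberwise _ (fun u => u i)]
  simp only [Finset.filter_filter]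
  simp only [sum_zmod_two, and_comm]

variable [Fintype Y]

/-- The negative joint entropy of the outputs and the first `k` inputs. -/
noncomputable def negJointEntropy (W : ZMod 2 → Y → ℝ) (G : Matrix (Fin m) (Fin m) (ZMod 2))
    (k : ℕ) : ℝ :=
  ∑ y : Fin m → Y, ∑ w : Fin k → ZMod 2, jointProb W G k y w * Real.log (jointProb W G k y w)

theorem splitChannel_eq_two_mul_jointProb (W : ZMod 2 → Y → ℝ)
    (G : Matrix (Fin m) (Fin m) (ZMod 2)) (i : Fin m) (x : ZMod 2) (y : Fin m → Y)
    (w : Fin i.val → ZMod 2) :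
    splitChannel W G i x (y, w) = 2 * jointProb W G (i.val + 1) y (Fin.snoc w x) := by
  have hm : (2 : ℝ) ^ m = 2 ^ (m - 1) * 2 := by
    rw [← pow_succ, Nat.sub_add_cancel (Nat.one_le_of_lt i.2)]
  simp only [splitChannel_eq, jointProb, truncate_succ_eq_snoc_iff, initial_eq_truncate,
    Finset.prod_div_distrib, ← Finset.sum_div]
  simp only [Finset.prod_const, Finset.card_univ, Fintype.card_fin, hm]
  field_simp

theorem jointProb_nonneg {W : ZMod 2 → Y → ℝ} (hW : IsBDMC W)
    (G : Matrix (Fin m) (Fin m) (ZMod 2)) (k : ℕ) (y : Fin m → Y) (w : Fin k → ZMod 2) :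
    0 ≤ jointProb W G k y w :=
  Finset.sum_nonneg fun _ _ => Finset.prod_nonneg fun _ _ => div_nonneg (hW.1 _ _) zero_le_two

theorem sum_jointProb {W : ZMod 2 → Y → ℝ} (hW : IsBDMC W)
    (G : Matrix (Fin m) (Fin m) (ZMod 2)) (k : ℕ) :
    ∑ y : Fin m → Y, ∑ w : Fin k → ZMod 2, jointProb W G k y w = 1 := by
  simp only [jointProb, Finset.sum_fiberwise, Finset.prod_div_distrib]
  rw [Finset.sum_comm]
  simp only [← Finset.sum_div]
  rw [Finset.sum_congr rfl fun u _ =>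
    sum_prod_eq_one (f := fun j => W (Matrix.vecMul u G j)) fun j => hW.2 _]
  simp [ZMod.card]

theorem channelInfo_splitChannel {W : ZMod 2 → Y → ℝ} (hW : IsBDMC W)
    (G : Matrix (Fin m) (Fin m) (ZMod 2)) (i : Fin m) :
    channelInfo (splitChannel W G i) =
      negJointEntropy W G (i.val + 1) - negJointEntropy W G i.val + Real.log 2 := by
  have h1 : ∀ (y : Fin m → Y) (w : Fin i.val → ZMod 2),
      symbolInfo (splitChannel W G i 0 (y, w)) (splitChannel W G i 1 (y, w)) =
        jointProb W G (i.val + 1) y (Fin.snoc w 0) *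
            Real.log (jointProb W G (i.val + 1) y (Fin.snoc w 0)) +
          jointProb W G (i.val + 1) y (Fin.snoc w 1) *
            Real.log (jointProb W G (i.val + 1) y (Fin.snoc w 1)) -
          jointProb W G i.val y w * Real.log (jointProb W G i.val y w) +
          jointProb W G i.val y w * Real.log 2 := by
    intro y w
    rw [splitChannel_eq_two_mul_jointProb, splitChannel_eq_two_mul_jointProb, symbolInfo_mul,
      symbolInfo_eq (jointProb_nonneg hW G _ y _) (jointProb_nonneg hW G _ y _),
      ← jointProb_eq_add]
    ring
  have h2 : negJointEntropy W G (i.val + 1) = ∑ y : Fin m → Y, ∑ w : Fin i.val → ZMod 2,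
      (jointProb W G (i.val + 1) y (Fin.snoc w 0) *
          Real.log (jointProb W G (i.val + 1) y (Fin.snoc w 0)) +
        jointProb W G (i.val + 1) y (Fin.snoc w 1) *
          Real.log (jointProb W G (i.val + 1) y (Fin.snoc w 1))) := by
    refine Finset.sum_congr rfl fun y _ => ?_
    rw [← (Fin.snocEquiv fun _ : Fin (i.val + 1) => ZMod 2).sum_comp,
      Fintype.sum_prod_type_right]
    exact Finset.sum_congr rfl fun w _ => sum_zmod_two _
  have h3 := sum_jointProb hW G i.val
  rw [channelInfo, Fintype.sum_prod_type]
  rw [h2]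
  simp only [h1, negJointEntropy, Finset.sum_add_distrib, Finset.sum_sub_distrib,
    ← Finset.sum_mul, h3]
  ring

theorem sum_channelInfo_splitChannel {W : ZMod 2 → Y → ℝ} (hW : IsBDMC W)
    {G : Matrix (Fin m) (Fin m) (ZMod 2)} (hG : IsUnit G.det) :
    ∑ i, channelInfo (splitChannel W G i) = m * channelInfo W := by
  classical
  let e : (Fin m → ZMod 2) ≃ (Fin m → ZMod 2) := Equiv.ofBijective (fun u => Matrix.vecMul u G)
    (Finite.injective_iff_bijective.1
      (Matrix.vecMul_injective_iff_isUnit.2 ((Matrix.isUnit_iff_isUnit_det G).2 hG)))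
  have hm : negJointEntropy W G m =
      m * ∑ z : Y × ZMod 2, W z.2 z.1 / 2 * Real.log (W z.2 z.1 / 2) := by
    have h1 : ∀ y w, jointProb W G m y w = ∏ j, W (e w j) (y j) / 2 := by
      intro y w
      have h : ({u : Fin m → ZMod 2 | truncate m u = w} : Finset _) = {w} := by
        ext u
        simp only [Finset.mem_filter, Finset.mem_univ, true_and, Finset.mem_singleton]
        have : truncate m u = u := by
          funext j
          simp [truncate]
        rw [this]
      rw [jointProb, h, Finset.sum_singleton]
      rfl
    rw [← sum_mul_log_prod, ← (Equiv.arrowProdEquivProdArrow (Fin m) (fun _ => Y)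
      (fun _ => ZMod 2)).symm.sum_comp, Fintype.sum_prod_type, negJointEntropy]
    · refine Finset.sum_congr rfl fun y _ => ?_
      simp only [h1]
      exact e.sum_comp fun x =>
        (∏ j, W (x j) (y j) / 2) * Real.log (∏ j, W (x j) (y j) / 2)
    · rw [Fintype.sum_prod_type_right]
      simp only [← Finset.sum_div, hW.2]
      simp [ZMod.card]
  have h0 : negJointEntropy W G 0 =
      m * ∑ y, (W 0 y / 2 + W 1 y / 2) * Real.log (W 0 y / 2 + W 1 y / 2) := by
    have h1 : ∀ y w, jointProb W G 0 y w = ∏ j, (W 0 (y j) / 2 + W 1 (y j) / 2) := by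
      intro y w
      have h : ({u : Fin m → ZMod 2 | truncate 0 u = w} : Finset _) = Finset.univ :=
        Finset.filter_true_of_mem fun u _ => Subsingleton.elim _ _
      rw [jointProb, h]
      refine (e.sum_comp fun x => ∏ j, W (x j) (y j) / 2).trans ?_
      rw [← Fintype.piFinset_univ,
        Finset.sum_prod_piFinset Finset.univ fun j x => W x (y j) / 2]
      exact Finset.prod_congr rfl fun j _ => sum_zmod_two _
    rw [← sum_mul_log_prod, negJointEntropy]
    · simp only [h1]
      simp
    · simp only [Finset.sum_add_distrib, ← Finset.sum_div, hW.2]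
      norm_num
  have hsum := Finset.sum_range_sub (negJointEntropy W G) m
  rw [← Fin.sum_univ_eq_sum_range (fun k => negJointEntropy W G (k + 1) - negJointEntropy W G k),
    hm, h0, Fintype.sum_prod_type] at hsum
  simp only [channelInfo_splitChannel hW G, Finset.sum_add_distrib, hsum]
  have h4 : channelInfo W = ∑ y, (∑ x, W x y / 2 * Real.log (W x y / 2) -
      (W 0 y / 2 + W 1 y / 2) * Real.log (W 0 y / 2 + W 1 y / 2) +
      (W 0 y / 2 + W 1 y / 2) * Real.log 2) := by
    refine Finset.sum_congr rfl fun y _ => ?_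
    have h5 : ∀ x, 0 ≤ W x y / 2 := fun x => div_nonneg (hW.1 x y) zero_le_two
    have h6 := symbolInfo_mul (c := 2) (W 0 y / 2) (W 1 y / 2)
    rw [mul_div_cancel₀ _ two_ne_zero, mul_div_cancel₀ _ two_ne_zero,
      symbolInfo_eq (h5 0) (h5 1)] at h6
    rw [h6, sum_zmod_two]
    ring
  rw [h4, Finset.sum_add_distrib, Finset.sum_sub_distrib, ← Finset.sum_mul,
    Finset.sum_add_distrib, ← Finset.sum_div, ← Finset.sum_div, hW.2, hW.2]
  simp
  ring

end Conservation

theorem sum_fiber_eq_sum_image {U C : Type*} [Fintype U] [Fintype C] [DecidableEq U]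
    [DecidableEq C] (f : U → C) {F : Finset U → ℝ} (hF : F ∅ = 0) :
    ∑ c, F {u | f u = c} = ∑ s ∈ Finset.univ.image fun v => ({u | f u = f v} : Finset U), F s := by
  have h1 : ∑ c, F {u | f u = c} = ∑ c ∈ Finset.univ.image f, F {u | f u = c} := by
    refine (Finset.sum_subset (Finset.subset_univ _) fun c _ hc => ?_).symm
    rw [Finset.filter_eq_empty_iff.2, hF]
    rintro u - rfl
    exact hc (Finset.mem_image_of_mem f (Finset.mem_univ u))
  rw [h1, ← Finset.sum_image (f := F) (g := fun c => ({u | f u = c} : Finset U)),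
    Finset.image_image]
  · rfl
  · intro c hc c' _ hcc
    obtain ⟨u, -, rfl⟩ := Finset.mem_image.1 (Finset.mem_coe.1 hc)
    have : u ∈ ({v | f v = f u} : Finset U) := by simp
    rw [show ({v | f v = f u} : Finset U) = _ from hcc] at this
    simpa using this

theorem sum_fiber_congr {U C C' : Type*} [Fintype U] [Fintype C] [Fintype C'] [DecidableEq C]
    [DecidableEq C'] {f : U → C} {f' : U → C'} (h : ∀ u v, f u = f v ↔ f' u = f' v)
    {F : Finset U → ℝ} (hF : F ∅ = 0) :
    ∑ c, F {u | f u = c} = ∑ c, F {u | f' u = c} := by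
  classical
  simp only [sum_fiber_eq_sum_image _ hF, h]

theorem sum_fiber_embedding {U V C C' : Type} [Fintype U] [Fintype V] [Fintype C] [Fintype C']
    [DecidableEq C] [DecidableEq C'] {f : U → C} {f' : V → C'} {i : U → V}
    (hi : Function.Injective i) (h : ∀ u v, f u = f v ↔ f' (i u) = f' (i v))
    {p : ZMod 2 → U → ℝ} {q : ZMod 2 → V → ℝ} (hpq : ∀ x u, q x (i u) = p x u)
    (hq : ∀ x v, v ∉ Set.range i → q x v = 0) :
    ∑ c, symbolInfo (∑ u with f u = c, p 0 u) (∑ u with f u = c, p 1 u) =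
      ∑ c, symbolInfo (∑ v with f' v = c, q 0 v) (∑ v with f' v = c, q 1 v) := by
  have h1 : ∀ x c, ∑ v with f' v = c, q x v = ∑ u with f' (i u) = c, p x u := by
    intro x c
    simp only [Finset.sum_filter]
    refine (Finset.sum_of_injOn i hi.injOn (fun _ _ => Finset.mem_coe.2 (Finset.mem_univ _))
      (fun v _ hv => ?_) fun u _ => by rw [hpq]).symm
    rw [hq x v (by simpa using hv), ite_self]
  simp only [h1]
  exact sum_fiber_congr (F := fun s => symbolInfo (∑ u ∈ s, p 0 u) (∑ u ∈ s, p 1 u)) h (by simp)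

theorem initial_eq_initial_iff {m : ℕ} {i : Fin m} {u v : Fin m → ZMod 2} :
    initial i u = initial i v ↔ ∀ j, j < i → u j = v j := by
  rw [funext_iff]
  exact ⟨fun h j hj => h ⟨j, hj⟩, fun h j => h _ j.2⟩

theorem splitChannel_eq_sum_ite {m : ℕ} {Y : Type} [Fintype Y] (W : ZMod 2 → Y → ℝ)
    (G : Matrix (Fin m) (Fin m) (ZMod 2)) (i : Fin m) (x : ZMod 2) (y : Fin m → Y)
    (w : Fin i.val → ZMod 2) :
    splitChannel W G i x (y, w) = ∑ u : Fin m → ZMod 2 with initial i u = w,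
      if u i = x then 1 / 2 ^ (m - 1) * ∏ j, W (Matrix.vecMul u G j) (y j) else 0 := by
  rw [splitChannel_eq, Finset.mul_sum, ← Finset.sum_filter, Finset.filter_filter]
  simp only [and_comm]

theorem splitChannel_splitChannel_eq {l r : ℕ} {Y : Type} [Fintype Y] (W : ZMod 2 → Y → ℝ)
    (A : Matrix (Fin l) (Fin l) (ZMod 2)) (B : Matrix (Fin r) (Fin r) (ZMod 2)) (i : Fin l)
    (j : Fin r) (x : ZMod 2) (y : Fin r → Fin l → Y)
    (c : (Fin r → Fin i.val → ZMod 2) × (Fin j.val → ZMod 2)) :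
    splitChannel (splitChannel W A i) B j x (fun b => (y b, c.1 b), c.2) =
      ∑ vt : (Fin r → ZMod 2) × (Fin r → Fin l → ZMod 2)
        with ((fun b => initial i (vt.2 b)), initial j vt.1) = c,
        if vt.1 j = x ∧ ∀ b, vt.2 b i = Matrix.vecMul vt.1 B b then
          1 / 2 ^ (r - 1) * (1 / 2 ^ (l - 1)) ^ r *
            ∏ b, ∏ a, W (Matrix.vecMul (vt.2 b) A a) (y b a)
        else 0 := by
  classical
  have h1 : ∀ v : Fin r → ZMod 2,
      ∏ b, splitChannel W A i (Matrix.vecMul v B b) (y b, c.1 b) =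
        ∑ t : Fin r → Fin l → ZMod 2,
          if (∀ b, t b i = Matrix.vecMul v B b) ∧ (fun b => initial i (t b)) = c.1 then
          (1 / 2 ^ (l - 1)) ^ r * ∏ b, ∏ a, W (Matrix.vecMul (t b) A a) (y b a) else 0 := by
    intro v
    simp only [splitChannel_eq]
    rw [Finset.prod_mul_distrib, Finset.prod_univ_sum, ← Finset.sum_filter, ← Finset.mul_sum]
    simp only [Finset.prod_const, Finset.card_univ, Fintype.card_fin]
    congr 1
    refine Finset.sum_congr ?_ fun _ _ => rfl
    ext t
    simp [funext_iff, forall_and]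
  rw [splitChannel_eq, Finset.sum_filter, Finset.sum_filter, Fintype.sum_prod_type, Finset.mul_sum]
  refine Finset.sum_congr rfl fun v _ => ?_
  rw [h1]
  split_ifs with h
  · rw [Finset.mul_sum]
    refine Finset.sum_congr rfl fun t _ => ?_
    simp only [Prod.ext_iff, h, and_true, true_and, mul_ite, mul_zero, ← mul_assoc]
    split_ifs <;> first | rfl | (exfalso; tauto)
  · rw [mul_zero]
    refine (Finset.sum_eq_zero fun t _ => ?_).symm
    rw [ite_eq_right_iff]
    intro h2
    rw [if_neg]
    rintro ⟨h3, -⟩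
    exact h ⟨h3, congrArg Prod.snd h2⟩

/-- The row-major identification of pairs of indices with indices of a Kronecker product. -/
def kronIndex {l r N : ℕ} (h : l * r = N) : Fin l × Fin r ≃ Fin N :=
  finProdFinEquiv.trans (finCongr h)

theorem kronIndex_lt_iff {l r N : ℕ} (h : l * r = N) (a i : Fin l) (b j : Fin r) :
    kronIndex h (a, b) < kronIndex h (i, j) ↔ a < i ∨ a = i ∧ b < j := by
  simp only [kronIndex, Fin.lt_def, Fin.ext_iff, Equiv.trans_apply, finCongr_apply, Fin.val_cast,
    finProdFinEquiv_apply_val]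
  have hb := b.2
  have hj := j.2
  rcases lt_trichotomy a.val i.val with h1 | h1 | h1
  · have : r * (a.val + 1) ≤ r * i.val := Nat.mul_le_mul_left r h1
    rw [mul_add] at this
    constructor <;> intro <;> omega
  · simp [h1]
  · have : r * (i.val + 1) ≤ r * a.val := Nat.mul_le_mul_left r h1
    rw [mul_add] at this
    constructor <;> intro <;> omega

/-- The Kronecker product with rows and columns indexed in row-major order. -/
def kronFin {l r N : ℕ} (h : l * r = N) (A : Matrix (Fin l) (Fin l) (ZMod 2))
    (B : Matrix (Fin r) (Fin r) (ZMod 2)) : Matrix (Fin N) (Fin N) (ZMod 2) :=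
  Matrix.reindex (kronIndex h) (kronIndex h) (Matrix.kroneckerMap (· * ·) A B)

theorem vecMul_kronFin {l r N : ℕ} (h : l * r = N) (A : Matrix (Fin l) (Fin l) (ZMod 2))
    (B : Matrix (Fin r) (Fin r) (ZMod 2)) (u : Fin N → ZMod 2) (a : Fin l) (b : Fin r) :
    Matrix.vecMul u (kronFin h A B) (kronIndex h (a, b)) =
      Matrix.vecMul (fun a' => Matrix.vecMul (fun b' => u (kronIndex h (a', b'))) B b) A a := by
  simp only [Matrix.vecMul, dotProduct, kronFin, Matrix.reindex_apply, Matrix.submatrix_apply,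
    Equiv.symm_apply_apply]
  rw [← (kronIndex h).sum_comp, Fintype.sum_prod_type]
  refine Finset.sum_congr rfl fun a' _ => ?_
  rw [Finset.sum_mul]
  refine Finset.sum_congr rfl fun b' _ => ?_
  simp only [Equiv.symm_apply_apply, Matrix.kroneckerMap_apply]
  ring

theorem channelInfo_splitChannel_kronFin {l r N : ℕ} (h : l * r = N) {Y : Type} [Fintype Y]
    (W : ZMod 2 → Y → ℝ) (A : Matrix (Fin l) (Fin l) (ZMod 2))
    {B : Matrix (Fin r) (Fin r) (ZMod 2)} (hB : IsUnit B.det) (i : Fin l) (j : Fin r) :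
    channelInfo (splitChannel W (kronFin h A B) (kronIndex h (i, j))) =
      channelInfo (splitChannel (splitChannel W A i) B j) := by
  classical
  let e : (Fin r → ZMod 2) ≃ (Fin r → ZMod 2) := Equiv.ofBijective (fun u => Matrix.vecMul u B)
    (Finite.injective_iff_bijective.1
      (Matrix.vecMul_injective_iff_isUnit.2 ((Matrix.isUnit_iff_isUnit_det B).2 hB)))
  let ey : (Fin r → Fin l → Y) ≃ (Fin N → Y) :=
    ((Equiv.piComm _).trans (Equiv.curry _ _ _).symm).trans
      (Equiv.arrowCongr (kronIndex h) (Equiv.refl Y))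
  have hey : ∀ y a b, ey y (kronIndex h (a, b)) = y b a := by
    intro y a b
    simp [ey]
  rw [channelInfo, channelInfo, Fintype.sum_prod_type, Fintype.sum_prod_type, ← ey.sum_comp,
    ← (Equiv.arrowProdEquivProdArrow (Fin r) (fun _ => Fin l → Y)
      (fun _ => Fin i.val → ZMod 2)).symm.sum_comp, Fintype.sum_prod_type]
  refine Finset.sum_congr rfl fun y _ => ?_
  rw [← Fintype.sum_prod_type']
  have hR := splitChannel_splitChannel_eq W A B i j
  refine Eq.trans ?_ (Finset.sum_congr rfl fun c _ =>
    congrArg₂ symbolInfo (hR 0 y c).symm (hR 1 y c).symm)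
  simp only [splitChannel_eq_sum_ite]
  let ι : (Fin N → ZMod 2) → (Fin r → ZMod 2) × (Fin r → Fin l → ZMod 2) := fun u =>
    (fun b => u (kronIndex h (i, b)), fun b a => e (fun b' => u (kronIndex h (a, b'))) b)
  have hrow : ∀ u v : Fin N → ZMod 2, ∀ a, (∀ b, (ι u).2 b a = (ι v).2 b a) ↔
      ∀ b, u (kronIndex h (a, b)) = v (kronIndex h (a, b)) := by
    intro u v a
    rw [← funext_iff, ← funext_iff]
    exact e.apply_eq_iff_eq
  have hconst : (1 : ℝ) / 2 ^ (N - 1) = 1 / 2 ^ (r - 1) * (1 / 2 ^ (l - 1)) ^ r := by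
    obtain ⟨l, rfl⟩ : ∃ k, l = k + 1 := ⟨l - 1, by have := i.2; omega⟩
    obtain ⟨r, rfl⟩ : ∃ k, r = k + 1 := ⟨r - 1, by have := j.2; omega⟩
    subst h
    have : (l + 1) * (r + 1) - 1 = r + l * (r + 1) := by
      rw [add_mul, one_mul, ← add_assoc, Nat.add_sub_cancel, add_comm]
    rw [this, one_div_pow, ← pow_mul, pow_add, Nat.add_sub_cancel, Nat.add_sub_cancel]
    field_simp
  refine sum_fiber_embedding (i := ι)
    (f' := fun vt => ((fun b => initial i (vt.2 b)), initial j vt.1))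
    (p := fun x u => if u (kronIndex h (i, j)) = x then 1 / 2 ^ (N - 1) *
      ∏ k, W (Matrix.vecMul u (kronFin h A B) k) (ey y k) else 0)
    (q := fun x vt => if vt.1 j = x ∧ ∀ b, vt.2 b i = Matrix.vecMul vt.1 B b then
          1 / 2 ^ (r - 1) * (1 / 2 ^ (l - 1)) ^ r *
            ∏ b, ∏ a, W (Matrix.vecMul (vt.2 b) A a) (y b a)
        else 0) ?_ ?_ ?_ ?_
  · intro u v huv
    funext k
    obtain ⟨⟨a, b⟩, rfl⟩ := (kronIndex h).surjective k
    exact (hrow u v a).1 (fun b => by rw [huv]) b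
  · intro u v
    rw [initial_eq_initial_iff, Prod.ext_iff, initial_eq_initial_iff, funext_iff]
    simp only [initial_eq_initial_iff]
    constructor
    · intro huv
      refine ⟨fun b a ha => (hrow u v a).2 (fun b => huv _ ?_) b, fun b hb => huv _ ?_⟩
      · exact (kronIndex_lt_iff h _ _ _ _).2 (Or.inl ha)
      · exact (kronIndex_lt_iff h _ _ _ _).2 (Or.inr ⟨rfl, hb⟩)
    · rintro ⟨h1, h2⟩ k hk
      obtain ⟨⟨a, b⟩, rfl⟩ := (kronIndex h).surjective k
      rcases (kronIndex_lt_iff h _ _ _ _).1 hk with ha | ⟨rfl, hb⟩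
      · exact (hrow u v a).1 (fun b => h1 b a ha) b
      · exact h2 b hb
  · intro x u
    refine if_congr (and_iff_left fun b => rfl) ?_ rfl
    rw [hconst, ← (kronIndex h).prod_comp, Fintype.prod_prod_type_right]
    simp only [hey, vecMul_kronFin]
    rfl
  · rintro x ⟨v, t⟩ hvt
    refine if_neg fun hh => hvt ⟨fun k => e.symm (fun b => t b ((kronIndex h).symm k).1)
      ((kronIndex h).symm k).2, ?_⟩
    have hv : (fun b => t b i) = e v := funext hh.2
    simp [ι, hv]

theorem isUnit_det_kronPow {l : ℕ} {G : Matrix (Fin l) (Fin l) (ZMod 2)} (hG : IsUnit G.det)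
    (n : ℕ) : IsUnit (kronPow G n).det := by
  induction n with
  | zero =>
    rw [kronPow, Matrix.det_one]
    exact isUnit_one
  | succ n ih =>
    rw [kronPow, Matrix.det_reindex_self]
    rw [show (Matrix.kroneckerMap (· * ·) G (kronPow G n)).det = _ from
      Matrix.det_kronecker G (kronPow G n)]
    exact (hG.pow _).mul (ih.pow _)

theorem sum_channelInfo_kronPow_zero {l : ℕ} {Y : Type} [Fintype Y] {W : ZMod 2 → Y → ℝ}
    (hW : IsBDMC W) (G : Matrix (Fin l) (Fin l) (ZMod 2)) (φ : ℝ → ℝ) :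
    ∑ i, φ (channelInfo (splitChannel W (kronPow G 0) i)) = φ (channelInfo W) := by
  have h := sum_channelInfo_splitChannel hW (G := (1 : Matrix (Fin 1) (Fin 1) (ZMod 2)))
    (by rw [Matrix.det_one]; exact isUnit_one)
  rw [Fin.sum_univ_one, Nat.cast_one, one_mul] at h
  rw [← h]
  exact Fin.sum_univ_one _

theorem sum_channelInfo_kronPow_succ {l : ℕ} {Y : Type} [Fintype Y] (W : ZMod 2 → Y → ℝ)
    {G : Matrix (Fin l) (Fin l) (ZMod 2)} (hG : IsUnit G.det) (φ : ℝ → ℝ) (n : ℕ) :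
    ∑ i, φ (channelInfo (splitChannel W (kronPow G (n + 1)) i)) =
      ∑ i, ∑ j, φ (channelInfo (splitChannel (splitChannel W G i) (kronPow G n) j)) := by
  rw [← (kronIndex (pow_succ' l n).symm).sum_comp, Fintype.sum_prod_type]
  refine Finset.sum_congr rfl fun i _ => Finset.sum_congr rfl fun j _ => congrArg φ ?_
  exact channelInfo_splitChannel_kronFin (pow_succ' l n).symm W G (isUnit_det_kronPow hG n) i j

open scoped Classical in
theorem IsPolarizing.exists_gap {l : ℕ} {G : Matrix (Fin l) (Fin l) (ZMod 2)}
    (hG : IsPolarizing G) {δ : ℝ} (hδ : 0 < δ) :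
    ∃ ε > 0, ∀ {Y : Type} [Fintype Y] {W : ZMod 2 → Y → ℝ}, IsBDMC W →
      l * channelInfo W ^ 2 +
          (if channelInfo W / Real.log 2 ∈ Set.Ioo δ (1 - δ) then ε else 0) ≤
        ∑ i, channelInfo (splitChannel W G i) ^ 2 := by
  have h2 : 0 < Real.log 2 := Real.log_pos one_lt_two
  have h2' : Real.log 2 < 1 := by have := Real.log_two_lt_d9; linarith
  have hvar : ∀ {Y : Type} [Fintype Y] {W : ZMod 2 → Y → ℝ}, IsBDMC W →
      ∑ i, channelInfo (splitChannel W G i) ^ 2 = l * channelInfo W ^ 2 +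
        ∑ i, (channelInfo (splitChannel W G i) - channelInfo W) ^ 2 := by
    intro Y _ W hW
    simp only [sub_sq, Finset.sum_add_distrib, Finset.sum_sub_distrib, ← Finset.sum_mul,
      ← Finset.mul_sum, sum_channelInfo_splitChannel hW hG.1]
    simp
    ring
  by_cases hδ1 : δ < 1
  swap
  · refine ⟨1, one_pos, fun {Y} _ W hW => ?_⟩
    rw [if_neg fun h => by linarith [h.1, h.2], hvar hW]
    have := Finset.sum_nonneg fun i (_ : i ∈ Finset.univ) =>
      sq_nonneg (channelInfo (splitChannel W G i) - channelInfo W)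
    linarith
  set t := δ * Real.log 2 / 2 with ht_def
  have ht : 0 < t := by positivity
  have ht1 : t < 1 := by nlinarith
  have hlog : 0 < -Real.log t := by linarith [Real.log_neg ht ht1]
  refine ⟨(2 * t / -Real.log t * (δ * Real.log 2)) ^ 2, by positivity, fun {Y} _ W hW => ?_⟩
  rw [hvar hW]
  gcongr
  split_ifs with h
  · obtain ⟨i, j, k, hjk, hij, hik, hj, hk⟩ := hG.exists_two_columns
    refine le_trans ?_ (Finset.single_le_sum (f := fun i =>
      (channelInfo (splitChannel W G i) - channelInfo W) ^ 2) (fun i _ => sq_nonneg _)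
      (Finset.mem_univ i))
    have hgap := channelInfo_add_le_splitChannel hW hjk hij hik hj hk
    have hlow : δ * Real.log 2 < channelInfo W := (lt_div_iff₀ h2).1 h.1
    have hup : channelInfo W < (1 - δ) * Real.log 2 := (div_lt_iff₀ h2).1 h.2
    have hov : 2 * t / -Real.log t ≤ overlap W := by
      rw [div_le_iff₀ hlog]
      linarith [log_two_le_channelInfo_add hW ht]
    have := mul_le_mul hov hlow.le (by positivity) (le_trans (by positivity) hov)
    refine pow_le_pow_left₀ (by positivity) ?_ 2
    linarith
  · exact Finset.sum_nonneg fun i _ => sq_nonneg _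

theorem sum_kronPow_le_of_step {l : ℕ} {G : Matrix (Fin l) (Fin l) (ZMod 2)}
    (hG : IsUnit G.det) {φ ψ : ℝ → ℝ}
    (hstep : ∀ {Y : Type} [Fintype Y] {W : ZMod 2 → Y → ℝ}, IsBDMC W →
      φ (channelInfo W) ≤ ∑ i, ψ (channelInfo (splitChannel W G i))) (n : ℕ) :
    ∀ {Y : Type} [Fintype Y] {W : ZMod 2 → Y → ℝ}, IsBDMC W →
      ∑ i, φ (channelInfo (splitChannel W (kronPow G n) i)) ≤
        ∑ i, ψ (channelInfo (splitChannel W (kronPow G (n + 1)) i)) := by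
  induction n with
  | zero =>
    intro Y _ W hW
    rw [sum_channelInfo_kronPow_zero hW, sum_channelInfo_kronPow_succ W hG]
    simp only [sum_channelInfo_kronPow_zero (hW.splitChannel G _)]
    exact hstep hW
  | succ n ih =>
    intro Y _ W hW
    rw [sum_channelInfo_kronPow_succ W hG, sum_channelInfo_kronPow_succ W hG ψ]
    exact Finset.sum_le_sum fun i _ => ih (hW.splitChannel G i)

open scoped Classical in
/-- If `W` is a symmetric B-DMC and `G` is polarizing, then the fraction of
split channels of `G^{⊗n}` whose symmetric mutual information lies in `(δ, 1-δ)` tends to `0`. -/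
theorem polarization_of_isPolarizing {Y : Type} [Fintype Y] {l : ℕ}
    (W : ZMod 2 → Y → ℝ) (hW : IsBDMC W) (hsym : IsSymmetricBDMC W)
    (G : Matrix (Fin l) (Fin l) (ZMod 2)) (hG : IsPolarizing G)
    (δ : ℝ) (hδ : 0 < δ) :
    Filter.Tendsto
      (fun n : ℕ =>
        ((Finset.univ.filter (fun i : Fin (l ^ n) =>
            mutualInfo (splitChannel W (kronPow G n) i) ∈ Set.Ioo δ (1 - δ))).card : ℝ)
          / (l ^ n : ℝ))
      Filter.atTop (nhds 0) := by
  have h2 : 0 < Real.log 2 := Real.log_pos one_lt_two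
  obtain ⟨ε, hε, hstep⟩ := hG.exists_gap hδ
  have hl : 0 < (l : ℝ) := by
    obtain ⟨i, -⟩ := hG.exists_two_columns
    exact_mod_cast i.pos
  set E : ℕ → ℝ := fun n =>
    (∑ i, channelInfo (splitChannel W (kronPow G n) i) ^ 2) / (l ^ n : ℝ) with hE
  set c : ℕ → ℝ := fun n => ((Finset.univ.filter (fun i : Fin (l ^ n) =>
    mutualInfo (splitChannel W (kronPow G n) i) ∈ Set.Ioo δ (1 - δ))).card : ℝ) / (l ^ n : ℝ)
    with hc
  have hc0 : ∀ n, 0 ≤ c n := fun n => by positivity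
  have hEc : ∀ n, E n + ε / l * c n ≤ E (n + 1) := by
    intro n
    have h := sum_kronPow_le_of_step hG.1 (ψ := fun t => t ^ 2) (φ := fun t =>
      l * t ^ 2 + if t / Real.log 2 ∈ Set.Ioo δ (1 - δ) then ε else 0) hstep n hW
    simp only [Finset.sum_add_distrib, ← Finset.mul_sum, ← mutualInfo_eq] at h
    rw [← Finset.sum_filter, Finset.sum_const, nsmul_eq_mul] at h
    simp only [hE, hc]
    rw [le_div_iff₀ (by positivity)]
    refine le_trans (le_of_eq ?_) h
    field_simp
    ring
  have hmono : Monotone E := monotone_nat_of_le_succ fun n =>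
    (le_add_of_nonneg_right (mul_nonneg (by positivity) (hc0 n))).trans (hEc n)
  have hbdd : BddAbove (Set.range E) := by
    refine ⟨Real.log 2 ^ 2, ?_⟩
    rintro _ ⟨n, rfl⟩
    simp only [hE]
    rw [div_le_iff₀ (by positivity)]
    refine (Finset.sum_le_sum fun i _ => pow_le_pow_left₀ (channelInfo_nonneg
      (hW.splitChannel _ i)) (channelInfo_le (hW.splitChannel _ i)) 2).trans (le_of_eq ?_)
    simp [mul_comm]
  have hlim := tendsto_atTop_ciSup hmono hbdd
  have hdiff := ((hlim.comp (Filter.tendsto_add_atTop_nat 1)).sub hlim).const_mul (l / ε)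
  rw [sub_self, mul_zero] at hdiff
  refine squeeze_zero hc0 (fun n => ?_) hdiff
  have := mul_le_mul_of_nonneg_left (le_sub_iff_add_le'.2 (hEc n)) (a := l / ε) (by positivity)
  refine le_trans (le_of_eq ?_) this
  field_simp
end

section
/- Let W be a symmetric B-DMC with finite output alphabet 𝒴 and let G be an invertible ℓ×ℓ matrix over GF(2) that is not polarizing, i.e., some permutation of the columns of G yields an upper triangular matrix. Then for every n ≥ 1 and every i ∈ {1,…,ℓⁿ}, the split channel W^{(i)} defined from W and G^{⊗n} satisfies I(W^{(i)}) = I(W). -/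
open scoped BigOperators

/-- Upper triangular with ones on the diagonal, after listing the columns in the order `σ`. -/
def IsUnitriangularAlong {m : ℕ} (M : Matrix (Fin m) (Fin m) (ZMod 2))
    (σ : Equiv.Perm (Fin m)) : Prop :=
  (∀ i, M i (σ i) = 1) ∧ ∀ i j, j < i → M i (σ j) = 0

lemma isUnitriangularAlong_of_isUnit_det {m : ℕ} {M : Matrix (Fin m) (Fin m) (ZMod 2)}
    (hM : IsUnit M.det) {σ : Equiv.Perm (Fin m)}
    (hσ : IsUpperTriangular (Matrix.of fun i j => M i (σ j))) : IsUnitriangularAlong M σ := by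
  refine ⟨fun i => ?_, hσ⟩
  have hdet : (M.submatrix id σ).det = ∏ i, M i (σ i) :=
    Matrix.det_of_isUpperTriangular (M := M.submatrix id σ) fun i j h => hσ i j h
  rw [Matrix.det_permute'] at hdet
  have hne : ∏ i, M i (σ i) ≠ 0 := by
    rw [← hdet]
    exact ((Int.isUnit_iff_abs_eq.2 (by simp : |((Equiv.Perm.sign σ : ℤˣ) : ℤ)| = 1)).map
      (Int.castRingHom (ZMod 2)) |>.mul hM).ne_zero
  exact Fin.eq_one_of_ne_zero _ (Finset.prod_ne_zero_iff.1 hne i (Finset.mem_univ i))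

lemma exists_isUnitriangularAlong_kronPow {l : ℕ} {G : Matrix (Fin l) (Fin l) (ZMod 2)}
    {σ : Equiv.Perm (Fin l)} (hσ : IsUnitriangularAlong G σ) (n : ℕ) :
    ∃ τ, IsUnitriangularAlong (kronPow G n) τ := by
  induction n with
  | zero => exact ⟨1, fun i => Matrix.one_apply_eq i, fun i j h => Matrix.one_apply_ne h.ne'⟩
  | succ n ih =>
    obtain ⟨τ, hτ⟩ := ih
    set e : Fin l × Fin (l ^ n) ≃ Fin (l ^ (n + 1)) :=
      finProdFinEquiv.trans (finCongr (pow_succ' l n).symm) with he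
    refine ⟨e.permCongr (σ.prodCongr τ), fun i => ?_, fun i j hij => ?_⟩
    · obtain ⟨⟨a, b⟩, rfl⟩ := e.surjective i
      simp [kronPow, ← he, Equiv.permCongr_apply, hσ.1, hτ.1]
    · obtain ⟨⟨a, b⟩, rfl⟩ := e.surjective i
      obtain ⟨⟨c, d⟩, rfl⟩ := e.surjective j
      have hlt : d.val + l ^ n * c.val < b.val + l ^ n * a.val := hij
      simp only [kronPow, ← he, Equiv.permCongr_apply, Matrix.reindex_apply,
        Matrix.submatrix_apply, Equiv.symm_apply_apply, Equiv.prodCongr_apply, Prod.map_apply,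
        Matrix.kroneckerMap_apply]
      rcases lt_trichotomy c a with h | rfl | h
      · rw [hσ.2 _ _ h, zero_mul]
      · rw [hτ.2 _ _ (by rw [Fin.lt_def]; omega), mul_zero]
      · have h1 : l ^ n * (a.val + 1) ≤ l ^ n * c.val := Nat.mul_le_mul_left _ h
        have := b.isLt
        rw [mul_add] at h1
        omega

namespace IsUnitriangularAlong

variable {m : ℕ} {M : Matrix (Fin m) (Fin m) (ZMod 2)} {σ : Equiv.Perm (Fin m)}

lemma vecMul_apply_of_forall_lt (h : IsUnitriangularAlong M σ) {u : Fin m → ZMod 2} {j : Fin m}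
    (hu : ∀ k < j, u k = 0) : Matrix.vecMul u M (σ j) = u j := by
  rw [Matrix.vecMul, dotProduct, Finset.sum_eq_single j, h.1, mul_one]
  · intro k _ hk
    rcases lt_or_gt_of_ne hk with hk | hk
    · rw [hu k hk, zero_mul]
    · rw [h.2 k j hk, mul_zero]
  · simp

lemma forall_le_vecMul_eq_iff (h : IsUnitriangularAlong M σ) (u w : Fin m → ZMod 2) (i : Fin m) :
    (∀ j ≤ i, Matrix.vecMul u M (σ j) = Matrix.vecMul w M (σ j)) ↔ ∀ j ≤ i, u j = w j := by
  have key : ∀ j, (∀ k < j, u k = w k) →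
      (Matrix.vecMul u M (σ j) = Matrix.vecMul w M (σ j) ↔ u j = w j) := by
    intro j hj
    have := h.vecMul_apply_of_forall_lt (u := u - w) (j := j)
      fun k hk => by simp [hj k hk]
    rw [Matrix.sub_vecMul, Pi.sub_apply, Pi.sub_apply] at this
    rw [← sub_eq_zero, this, sub_eq_zero]
  constructor
  · intro hu j
    induction j using WellFoundedLT.induction with
    | ind j ih =>
      intro hj
      exact (key j fun k hk => ih k hk (hk.le.trans hj)).1 (hu j hj)
  · exact fun hu j hj => (key j fun k hk => hu k (hk.le.trans hj)).2 (hu j hj)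

lemma bijective_vecMul (h : IsUnitriangularAlong M σ) :
    Function.Bijective fun (u : Fin m → ZMod 2) j => Matrix.vecMul u M (σ j) := by
  rw [← Finite.injective_iff_bijective]
  intro u w huw
  funext i
  exact (h.forall_le_vecMul_eq_iff u w i).1 (fun j _ => congrFun huw j) i le_rfl

/-- Summing a product over all inputs with a prescribed initial segment factorises. -/
lemma sum_prod_vecMul (h : IsUnitriangularAlong M σ) (w : Fin m → ZMod 2) (i : Fin m)
    (f : Fin m → ZMod 2 → ℝ) :
    ∑ u : Fin m → ZMod 2 with ∀ j ≤ i, u j = w j, ∏ j, f j (Matrix.vecMul u M (σ j)) =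
      ∏ j, if j ≤ i then f j (Matrix.vecMul w M (σ j)) else f j 0 + f j 1 := by
  let T : Fin m → Finset (ZMod 2) := fun j =>
    if j ≤ i then {Matrix.vecMul w M (σ j)} else Finset.univ
  have hT : ∀ j, ∑ t ∈ T j, f j t =
      if j ≤ i then f j (Matrix.vecMul w M (σ j)) else f j 0 + f j 1 := by
    intro j
    by_cases hj : j ≤ i
    · simp [T, hj]
    · simp only [T, hj, if_false]
      exact Fin.sum_univ_two (f j)
  simp_rw [← hT, Finset.prod_univ_sum]
  refine Finset.sum_bijective _ h.bijective_vecMul (fun u => ?_) fun u _ => rfl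
  rw [Finset.mem_filter_univ, ← h.forall_le_vecMul_eq_iff, Fintype.mem_piFinset]
  refine forall_congr' fun j => ?_
  by_cases hj : j ≤ i <;> simp [T, hj]

end IsUnitriangularAlong

/-- The contribution of a single output, with likelihoods `p 0` and `p 1`, to `mutualInfo`. -/
noncomputable def mutualInfoTerm (p : ZMod 2 → ℝ) : ℝ :=
  ∑ x, (1 / 2) * p x * Real.logb 2 (p x / ((1 / 2) * p 0 + (1 / 2) * p 1))

lemma mutualInfo_eq_sum_term {Y : Type} [Fintype Y] (W : ZMod 2 → Y → ℝ) :
    mutualInfo W = ∑ y, mutualInfoTerm fun x => W x y := rfl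

lemma mutualInfoTerm_const_mul (c : ℝ) (p : ZMod 2 → ℝ) :
    mutualInfoTerm (fun x => c * p x) = c * mutualInfoTerm p := by
  rcases eq_or_ne c 0 with rfl | hc
  · simp [mutualInfoTerm]
  · rw [mutualInfoTerm, mutualInfoTerm, Finset.mul_sum]
    refine Finset.sum_congr rfl fun x _ => ?_
    rw [show (1 / 2) * (c * p 0) + (1 / 2) * (c * p 1) =
      c * ((1 / 2) * p 0 + (1 / 2) * p 1) by ring, mul_div_mul_left _ _ hc]
    ring

lemma mutualInfoTerm_add_left (a : ZMod 2) (p : ZMod 2 → ℝ) :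
    mutualInfoTerm (fun x => p (a + x)) = mutualInfoTerm p := by
  have hsum : (1 / 2) * p (a + 0) + (1 / 2) * p (a + 1) = (1 / 2) * p 0 + (1 / 2) * p 1 := by
    fin_cases a
    · rfl
    · exact add_comm _ _
  simp only [mutualInfoTerm, hsum]
  exact Fintype.sum_equiv (Equiv.addLeft a) _ _ fun x => rfl

section SplitChannel

variable {Y : Type} {m : ℕ}

/-- Extension of a prefix of length `i` by zeros. -/
def extendPrefix (i : Fin m) (v : Fin i.val → ZMod 2) (j : Fin m) : ZMod 2 :=
  if h : j < i then v ⟨j, h⟩ else 0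

lemma forall_le_eq_extendPrefix_add_single_iff (i : Fin m) (v : Fin i.val → ZMod 2) (x : ZMod 2)
    (u : Fin m → ZMod 2) :
    (∀ j ≤ i, u j = (extendPrefix i v + Pi.single i x : Fin m → ZMod 2) j) ↔
      u i = x ∧ ∀ j : Fin i.val, u (Fin.castLE i.isLt.le j) = v j := by
  constructor
  · intro h
    refine ⟨by simpa [extendPrefix] using h i le_rfl, fun j => ?_⟩
    have hj : Fin.castLE i.isLt.le j < i := j.isLt
    simpa [extendPrefix, hj, hj.ne] using h _ hj.le
  · rintro ⟨h, hv⟩ j hj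
    rcases hj.lt_or_eq with hj | rfl
    · simpa [extendPrefix, hj, hj.ne] using hv ⟨j, hj⟩
    · simpa [extendPrefix] using h

/-- The factor at position `j` of a split channel, given the prefix `v`, with `φ` standing for the
factor at position `i`. -/
def splitFactor (W : ZMod 2 → Y → ℝ) (M : Matrix (Fin m) (Fin m) (ZMod 2))
    (σ : Equiv.Perm (Fin m)) (i : Fin m) (v : Fin i.val → ZMod 2) (φ : Y → ℝ) (j : Fin m) (y : Y) :
    ℝ :=
  if j < i then W (Matrix.vecMul (extendPrefix i v) M (σ j)) y
  else if j = i then φ y else W 0 y + W 1 y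

variable (W : ZMod 2 → Y → ℝ) (M : Matrix (Fin m) (Fin m) (ZMod 2)) (σ : Equiv.Perm (Fin m))
  (i : Fin m) (v : Fin i.val → ZMod 2)

lemma prod_splitFactor (φ : Y → ℝ) (y : Fin m → Y) :
    ∏ j, splitFactor W M σ i v φ j (y j) =
      (∏ j ∈ Finset.univ.erase i, splitFactor W M σ i v 0 j (y j)) * φ (y i) := by
  rw [← Finset.prod_erase_mul _ _ (Finset.mem_univ i)]
  congr 1
  · refine Finset.prod_congr rfl fun j hj => ?_
    simp [splitFactor, Finset.ne_of_mem_erase hj]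
  · simp [splitFactor]

variable [Fintype Y]

lemma splitChannel_eq_prod_splitFactor {M : Matrix (Fin m) (Fin m) (ZMod 2)}
    {σ : Equiv.Perm (Fin m)} (h : IsUnitriangularAlong M σ) (x : ZMod 2) (y : Fin m → Y) :
    splitChannel W M i x (y, v) = 1 / 2 ^ (m - 1) *
      ∏ j, splitFactor W M σ i v (W (Matrix.vecMul (extendPrefix i v) M (σ i) + x)) j
        (y (σ j)) := by
  rw [splitChannel]
  congr 1
  simp_rw [← forall_le_eq_extendPrefix_add_single_iff i v x]
  simp_rw [← fun u : Fin m → ZMod 2 => Equiv.prod_comp σ fun j => W (Matrix.vecMul u M j) (y j)]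
  rw [h.sum_prod_vecMul _ i fun j t => W t (y (σ j))]
  refine Finset.prod_congr rfl fun j _ => ?_
  have hsingle : ∀ j ≤ i, Matrix.vecMul (Pi.single i x) M (σ j) = (Pi.single i x : Fin m → _) j :=
    fun j hj => h.vecMul_apply_of_forall_lt fun k hk => by simp [(hk.trans_le hj).ne]
  rw [Matrix.add_vecMul, Pi.add_apply, splitFactor]
  rcases lt_trichotomy j i with hj | rfl | hj
  · simp [hj, hj.le, hsingle j hj.le, hj.ne]
  · simp [hsingle j le_rfl]
  · simp [hj.not_ge, hj.not_gt, hj.ne']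

lemma sum_prod_splitFactor (hW : ∀ x, ∑ y, W x y = 1) (φ : Y → ℝ) :
    ∑ y : Fin m → Y, ∏ j, splitFactor W M σ i v φ j (y (σ j)) =
      2 ^ (m - 1 - i.val) * ∑ y, φ y := by
  rw [Fintype.sum_equiv (σ.arrowCongr (Equiv.refl Y)).symm
    (fun y => ∏ j, splitFactor W M σ i v φ j (y (σ j)))
    (fun y => ∏ j, splitFactor W M σ i v φ j (y j)) fun y => rfl, ← Fintype.prod_sum]
  have hfac : ∀ j, ∑ y, splitFactor W M σ i v φ j y =
      (if j = i then ∑ y, φ y else 1) * if i < j then 2 else 1 := by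
    intro j
    rcases lt_trichotomy j i with hj | rfl | hj
    · simp [splitFactor, hj, hj.ne, hj.not_gt, hW]
    · simp [splitFactor]
    · simp [splitFactor, hj, hj.ne', hj.not_gt, hW, Finset.sum_add_distrib]
      norm_num
  simp_rw [hfac]
  rw [Finset.prod_mul_distrib, Finset.prod_ite_eq' Finset.univ i, if_pos (Finset.mem_univ i),
    Finset.prod_ite, Finset.prod_const, Finset.prod_const_one, mul_one, Finset.filter_lt_eq_Ioi,
    Fin.card_Ioi, mul_comm]

lemma mutualInfo_splitChannel_of_isUnitriangularAlong (hW : ∀ x, ∑ y, W x y = 1)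
    {M : Matrix (Fin m) (Fin m) (ZMod 2)} {σ : Equiv.Perm (Fin m)}
    (h : IsUnitriangularAlong M σ) : mutualInfo (splitChannel W M i) = mutualInfo W := by
  have hterm : ∀ (v : Fin i.val → ZMod 2) (y : Fin m → Y),
      mutualInfoTerm (fun x => splitChannel W M i x (y, v)) = 1 / 2 ^ (m - 1) *
        ∏ j, splitFactor W M σ i v (fun y => mutualInfoTerm fun x => W x y) j (y (σ j)) := by
    intro v y
    simp_rw [splitChannel_eq_prod_splitFactor W i v h,
      fun φ => prod_splitFactor W M σ i v φ fun j => y (σ j), ← mul_assoc]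
    rw [mutualInfoTerm_const_mul, mutualInfoTerm_add_left _ fun x => W x (y (σ i))]
  rw [mutualInfo_eq_sum_term, Fintype.sum_prod_type_right]
  simp_rw [hterm, ← Finset.mul_sum, sum_prod_splitFactor W M σ i _ hW, ← mutualInfo_eq_sum_term]
  have hpow : (2 : ℝ) ^ (m - 1) = 2 ^ i.val * 2 ^ (m - 1 - i.val) := by
    rw [← pow_add]
    congr 1
    omega
  simp [hpow]
  field_simp

end SplitChannel

/-- If `G` is invertible but not polarizing (some column permutation of `G`
is upper triangular), then every split channel of `G^{⊗n}` has the same symmetric mutual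
information as `W`. -/
theorem mutualInfo_eq_of_not_polarizing {Y : Type} [Fintype Y] {l : ℕ}
    (W : ZMod 2 → Y → ℝ) (hW : IsBDMC W) (hsym : IsSymmetricBDMC W)
    (G : Matrix (Fin l) (Fin l) (ZMod 2)) (hGinv : IsUnit G.det)
    (hG : ∃ σ : Equiv.Perm (Fin l), IsUpperTriangular (Matrix.of fun i j => G i (σ j)))
    (n : ℕ) (hn : 1 ≤ n) (i : Fin (l ^ n)) :
    mutualInfo (splitChannel W (kronPow G n) i) = mutualInfo W := by
  obtain ⟨σ, hσ⟩ := hG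
  obtain ⟨τ, hτ⟩ :=
    exists_isUnitriangularAlong_kronPow (isUnitriangularAlong_of_isUnit_det hGinv hσ) n
  exact mutualInfo_splitChannel_of_isUnitriangularAlong W i hW.2 hτ
end

section
/- Let W be a symmetric B-DMC and let G be an invertible ℓ×ℓ matrix over GF(2) with all diagonal entries equal to 1 that is not upper triangular. Then there exist an index i ∈ {1,…,ℓ} and an integer k ≥ 2 such that the split channel W^{(i)} defined from W and G satisfies I(W^{(i)}) = I(W^k) and Z(W^{(i)}) = Z(W)^k. -/
open scoped BigOperators

/-- The input word with past `v`, current bit `x` at position `i`, and zeros afterwards. -/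
def inputWord {m : ℕ} (i : Fin m) (v : Fin i.val → ZMod 2) (x : ZMod 2) : Fin m → ZMod 2 :=
  fun j => if h : j.val < i.val then v ⟨j.val, h⟩ else if j = i then x else 0

theorem inputWord_self {m : ℕ} (i : Fin m) (v : Fin i.val → ZMod 2) (x : ZMod 2) :
    inputWord i v x i = x := by
  simp [inputWord]

theorem inputWord_castLE {m : ℕ} (i : Fin m) (v : Fin i.val → ZMod 2) (x : ZMod 2)
    (j : Fin i.val) : inputWord i v x (Fin.castLE i.isLt.le j) = v j := by
  simp [inputWord]

theorem inputWord_eq_add_single {m : ℕ} (i : Fin m) (v : Fin i.val → ZMod 2) (x : ZMod 2) :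
    inputWord i v x = inputWord i v 0 + Pi.single i x := by
  funext j
  by_cases hj : j = i
  · subst hj
    simp [inputWord]
  · simp [inputWord, hj]

theorem vecMul_inputWord {m : ℕ} (G : Matrix (Fin m) (Fin m) (ZMod 2)) (i : Fin m)
    (v : Fin i.val → ZMod 2) (x : ZMod 2) (j : Fin m) :
    Matrix.vecMul (inputWord i v x) G j = Matrix.vecMul (inputWord i v 0) G j + x * G i j := by
  rw [inputWord_eq_add_single, Matrix.add_vecMul]
  simp [Matrix.single_vecMul]

theorem eq_inputWord_iff {m : ℕ} (i : Fin m) (v : Fin i.val → ZMod 2) (x : ZMod 2)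
    (u : Fin m → ZMod 2) :
    (u i = x ∧ ∀ j : Fin i.val, u (Fin.castLE i.isLt.le j) = v j) ↔
      ∀ j ≤ i, u j = inputWord i v x j := by
  constructor
  · rintro ⟨hi, hv⟩ j hj
    rcases hj.lt_or_eq with h | rfl
    · have h' : j.val < i.val := h
      have := hv ⟨j.val, h'⟩
      simpa [inputWord, h'] using this
    · rw [hi, inputWord_self]
  · intro h
    refine ⟨by rw [h i le_rfl, inputWord_self], fun j => ?_⟩
    rw [h _ (by simp [Fin.le_def, j.isLt.le]), inputWord_castLE]

theorem ZMod.sum_univ_two {M : Type*} [AddCommMonoid M] (f : ZMod 2 → M) :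
    ∑ x, f x = f 0 + f 1 :=
  Fin.sum_univ_two f

/-- Right multiplication by an invertible matrix whose rows below `i` vanish on the first
columns permutes the words supported after position `i`. -/
theorem sum_vecMul_of_rows_eq_zero {M : Type*} [AddCommMonoid M] {m : ℕ}
    {G : Matrix (Fin m) (Fin m) (ZMod 2)} (hG : IsUnit G.det) {i : Fin m}
    (hrow : ∀ r, i < r → ∀ j ≤ i, G r j = 0) (f : (Fin m → ZMod 2) → M) :
    ∑ w ∈ Finset.univ.filter (fun w : Fin m → ZMod 2 => ∀ j ≤ i, w j = 0),
        f (Matrix.vecMul w G) =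
      ∑ w ∈ Finset.univ.filter (fun w : Fin m → ZMod 2 => ∀ j ≤ i, w j = 0), f w := by
  have hmaps : ∀ w ∈ Finset.univ.filter (fun w : Fin m → ZMod 2 => ∀ j ≤ i, w j = 0),
      Matrix.vecMul w G ∈
        Finset.univ.filter (fun w : Fin m → ZMod 2 => ∀ j ≤ i, w j = 0) := by
    intro w hw
    simp only [Finset.mem_filter, Finset.mem_univ, true_and] at hw ⊢
    intro j hj
    change ∑ r, w r * G r j = 0
    refine Finset.sum_eq_zero fun r _ => ?_
    rcases le_or_gt r i with hr | hr
    · rw [hw r hr, zero_mul]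
    · rw [hrow r hr j hj, mul_zero]
  have hinj : Function.Injective fun w : Fin m → ZMod 2 => Matrix.vecMul w G :=
    Matrix.vecMul_injective_of_isUnit ((Matrix.isUnit_iff_isUnit_det G).2 hG)
  exact Finset.sum_nbij (fun w => Matrix.vecMul w G) hmaps hinj.injOn
    (Finset.surjOn_of_injOn_of_card_le _ hmaps hinj.injOn le_rfl) fun _ _ => rfl

/-- If the rows after `i` vanish on the columns up to `i`, averaging over the future inputs
decouples the outputs after position `i`. -/
theorem splitChannel_eq_prod {Y : Type} [Fintype Y] {m : ℕ} (W : ZMod 2 → Y → ℝ)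
    {G : Matrix (Fin m) (Fin m) (ZMod 2)} (hG : IsUnit G.det) {i : Fin m}
    (hrow : ∀ r, i < r → ∀ j ≤ i, G r j = 0) (x : ZMod 2) (y : Fin m → Y)
    (v : Fin i.val → ZMod 2) :
    splitChannel W G i x (y, v) =
      (1 / 2 ^ (m - 1)) * ∏ j, if j ≤ i then
        W (Matrix.vecMul (inputWord i v 0) G j + x * G i j) (y j) else W 0 (y j) + W 1 (y j) := by
  unfold splitChannel
  congr 1
  simp only [eq_inputWord_iff, ← vecMul_inputWord]
  set e := inputWord i v x
  have hshift : ∑ u ∈ Finset.univ.filter (fun u : Fin m → ZMod 2 => ∀ j ≤ i, u j = e j),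
        ∏ j, W (Matrix.vecMul u G j) (y j) =
      ∑ w ∈ Finset.univ.filter (fun w : Fin m → ZMod 2 => ∀ j ≤ i, w j = 0),
        ∏ j, W (Matrix.vecMul e G j + Matrix.vecMul w G j) (y j) := by
    refine Finset.sum_nbij' (fun u => u - e) (fun w => e + w) ?_ ?_ ?_ ?_ ?_
    · intro u hu
      simpa [sub_eq_zero] using hu
    · intro w hw
      simpa using hw
    · intro u _
      simp
    · intro w _
      simp
    · intro u _
      simp [Matrix.sub_vecMul]
  have hV : Finset.univ.filter (fun w : Fin m → ZMod 2 => ∀ j ≤ i, w j = 0) =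
      Fintype.piFinset fun j => if j ≤ i then ({0} : Finset (ZMod 2)) else Finset.univ := by
    ext w
    simp only [Finset.mem_filter, Finset.mem_univ, true_and, Fintype.mem_piFinset]
    refine forall_congr' fun j => ?_
    by_cases hj : j ≤ i <;> simp [hj]
  rw [hshift, sum_vecMul_of_rows_eq_zero hG hrow
    fun t => ∏ j, W (Matrix.vecMul e G j + t j) (y j), hV,
    ← Finset.prod_univ_sum (f := fun j a => W (Matrix.vecMul e G j + a) (y j))]
  refine Finset.prod_congr rfl fun j _ => ?_
  by_cases hj : j ≤ i
  · simp [hj]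
  · simp only [hj, if_false]
    exact (Equiv.sum_comp (Equiv.addLeft (Matrix.vecMul e G j)) fun a => W a (y j)).trans
      (ZMod.sum_univ_two _)

/-- For a symmetric channel, translating the input amounts to permuting the output. -/
theorem IsSymmetricBDMC.exists_equiv {Y : Type} [Fintype Y] {W : ZMod 2 → Y → ℝ}
    (hW : IsSymmetricBDMC W) (c : ZMod 2) :
    ∃ τ : Y ≃ Y, ∀ x y, W (c + x) y = W x (τ y) := by
  obtain ⟨π, hπ, h⟩ := hW
  have hcases : ∀ a : ZMod 2, a = 0 ∨ a = 1 := by decide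
  have h11 : (1 + 1 : ZMod 2) = 0 := by decide
  rcases hcases c with rfl | rfl
  · exact ⟨Equiv.refl Y, fun x y => by simp⟩
  · refine ⟨hπ.toPerm, fun x y => ?_⟩
    rcases hcases x with rfl | rfl
    · simp [h]
    · simp [h, h11, hπ y]

/-- A degree-one homogeneous functional of a product channel with side outputs factors. -/
theorem sum_homogeneous_eq {Y ι : Type*} [Fintype Y] [Fintype ι] [DecidableEq ι]
    (φ : ℝ → ℝ → ℝ) (hφ : ∀ c a b, 0 ≤ c → φ (c * a) (c * b) = c * φ a b)
    (p : ι → Prop) [DecidablePred p] (B : ι → Y → ℝ) (hB : ∀ j y, 0 ≤ B j y)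
    (W : ZMod 2 → Y → ℝ) {c : ℝ} (hc : 0 ≤ c) :
    ∑ y : ι → Y, φ (c * ∏ j, if p j then W 0 (y j) else B j (y j))
        (c * ∏ j, if p j then W 1 (y j) else B j (y j)) =
      c * (∏ j : {j // ¬ p j}, ∑ y, B j y) *
        ∑ y : {j // p j} → Y, φ (∏ j, W 0 (y j)) (∏ j, W 1 (y j)) := by
  have hsplit : ∀ (x : ZMod 2) (y : ι → Y),
      (c * ∏ j, if p j then W x (y j) else B j (y j)) =
        (c * ∏ j : {j // ¬ p j}, B j (y j)) * ∏ j : {j // p j}, W x (y j) := by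
    intro x y
    rw [← Fintype.prod_subtype_mul_prod_subtype p]
    have h1 : (∏ j : {j // p j}, if p j then W x (y j) else B j (y j)) =
        ∏ j : {j // p j}, W x (y j) :=
      Finset.prod_congr rfl fun j _ => if_pos j.2
    have h2 : (∏ j : {j // ¬ p j}, if p j then W x (y j) else B j (y j)) =
        ∏ j : {j // ¬ p j}, B j (y j) :=
      Finset.prod_congr rfl fun j _ => if_neg j.2
    rw [h1, h2]
    ring
  have hnonneg : ∀ y : ι → Y, 0 ≤ c * ∏ j : {j // ¬ p j}, B j (y j) := fun y =>
    mul_nonneg hc (Finset.prod_nonneg fun j _ => hB _ _)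
  simp only [hsplit, hφ _ _ _ (hnonneg _)]
  refine (Equiv.sum_comp (Equiv.piEquivPiSubtypeProd p fun _ => Y) fun q =>
    (c * ∏ j : {j // ¬ p j}, B j (q.2 j)) *
      φ (∏ j : {j // p j}, W 0 (q.1 j)) (∏ j : {j // p j}, W 1 (q.1 j))).trans ?_
  rw [Fintype.sum_prod_type_right, Fintype.prod_sum, Finset.mul_sum _ _ c, Finset.sum_mul]
  exact Finset.sum_congr rfl fun q _ => by rw [Finset.mul_sum]

/-- Degree-one homogeneous functionals do not distinguish the split channel at the last
row violating upper triangularity from a power of `W`. -/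
theorem sum_splitChannel_eq_sum_prodChannel {Y : Type} [Fintype Y] {m : ℕ}
    {W : ZMod 2 → Y → ℝ} (hW : IsBDMC W) (hsym : IsSymmetricBDMC W)
    {G : Matrix (Fin m) (Fin m) (ZMod 2)} (hG : IsUnit G.det) {i : Fin m}
    (hrow : ∀ r, i < r → ∀ j ≤ i, G r j = 0)
    (φ : ℝ → ℝ → ℝ) (hφ : ∀ c a b, 0 ≤ c → φ (c * a) (c * b) = c * φ a b) :
    ∑ z, φ (splitChannel W G i 0 z) (splitChannel W G i 1 z) =
      ∑ y, φ (prodChannel W (Fintype.card {j // j ≤ i ∧ G i j = 1}) 0 y)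
        (prodChannel W (Fintype.card {j // j ≤ i ∧ G i j = 1}) 1 y) := by
  set B : Fin m → Y → ℝ := fun j y => if j ≤ i then W 0 y else W 0 y + W 1 y with hBdef
  have hB : ∀ j y, 0 ≤ B j y := by
    intro j y
    have h0 := hW.1 0 y
    have h1 := hW.1 1 y
    simp only [hBdef]
    split_ifs <;> positivity
  have hBsum : (∏ j : {j // ¬ (j ≤ i ∧ G i j = 1)}, ∑ y, B j y) = 2 ^ (m - 1 - i.val) := by
    have hval : ∀ j, ∑ y, B j y = if j ≤ i then 1 else 2 := by
      intro j
      simp only [hBdef]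
      split_ifs
      · exact hW.2 0
      · rw [Finset.sum_add_distrib, hW.2, hW.2]
        norm_num
    have hone : (∏ j : {j // j ≤ i ∧ G i j = 1}, ∑ y, B j y) = 1 :=
      Finset.prod_eq_one fun j _ => by rw [hval, if_pos j.2.1]
    have hall : (∏ j, ∑ y, B j y) = 2 ^ (m - 1 - i.val) := by
      simp only [hval]
      rw [Finset.prod_ite]
      have : Finset.univ.filter (fun j => ¬ j ≤ i) = Finset.Ioi i := by
        ext j
        simp
      rw [this]
      simp
    rw [← hall, ← Fintype.prod_subtype_mul_prod_subtype (fun j => j ≤ i ∧ G i j = 1), hone,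
      one_mul]
  have hpast : ∀ v : Fin i.val → ZMod 2,
      ∑ y, φ (splitChannel W G i 0 (y, v)) (splitChannel W G i 1 (y, v)) =
        (1 / 2 ^ (m - 1)) * 2 ^ (m - 1 - i.val) *
          ∑ y : {j // j ≤ i ∧ G i j = 1} → Y, φ (∏ j, W 0 (y j)) (∏ j, W 1 (y j)) := by
    intro v
    choose τ hτ using fun j => hsym.exists_equiv (Matrix.vecMul (inputWord i v 0) G j)
    have hperm : ∀ x y, splitChannel W G i x (y, v) = (1 / 2 ^ (m - 1)) *
        ∏ j, if j ≤ i ∧ G i j = 1 then W x (τ j (y j))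
          else B j ((if j ≤ i then τ j else Equiv.refl Y) (y j)) := by
      intro x y
      rw [splitChannel_eq_prod W hG hrow]
      congr 1
      refine Finset.prod_congr rfl fun j _ => ?_
      have hcases : ∀ a : ZMod 2, a = 0 ∨ a = 1 := by decide
      by_cases hj : j ≤ i
      · rcases hcases (G i j) with h | h <;> simp [hj, h, hτ, hBdef, ← hτ j 0]
      · simp [hj, hBdef]
    have hperm' : ∀ x y, splitChannel W G i x (y, v) = (1 / 2 ^ (m - 1)) *
        ∏ j, if j ≤ i ∧ G i j = 1
          then W x (Equiv.piCongrRight (fun j => if j ≤ i then τ j else Equiv.refl Y) y j)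
          else B j (Equiv.piCongrRight (fun j => if j ≤ i then τ j else Equiv.refl Y) y j) := by
      intro x y
      rw [hperm]
      congr 1
      refine Finset.prod_congr rfl fun j _ => ?_
      by_cases hj : j ≤ i <;> simp [hj]
    simp only [hperm']
    rw [Equiv.sum_comp (Equiv.piCongrRight fun j => if j ≤ i then τ j else Equiv.refl Y) fun y =>
      φ (1 / 2 ^ (m - 1) * ∏ j, if j ≤ i ∧ G i j = 1 then W 0 (y j) else B j (y j))
        (1 / 2 ^ (m - 1) * ∏ j, if j ≤ i ∧ G i j = 1 then W 1 (y j) else B j (y j)),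
      sum_homogeneous_eq φ hφ _ B hB W (by positivity), hBsum]
  have hconst : (2 : ℝ) ^ i.val * (1 / 2 ^ (m - 1) * 2 ^ (m - 1 - i.val)) = 1 := by
    have h : i.val + (m - 1 - i.val) = m - 1 := by omega
    have h2 : (2 : ℝ) ^ (m - 1) = 2 ^ i.val * 2 ^ (m - 1 - i.val) := by rw [← pow_add, h]
    rw [h2]
    field_simp
  rw [Fintype.sum_prod_type_right]
  simp only [hpast, Finset.sum_const, Finset.card_univ, Fintype.card_pi, ZMod.card,
    Finset.prod_const, Fintype.card_fin, nsmul_eq_mul, Nat.cast_pow, Nat.cast_ofNat]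
  rw [← mul_assoc, hconst, one_mul]
  have e := Fintype.equivFin {j // j ≤ i ∧ G i j = 1}
  refine Fintype.sum_equiv (Equiv.arrowCongr e (Equiv.refl Y)) _ _ fun y => ?_
  have hprod : ∀ x, ∏ j, W x (y j) =
      prodChannel W (Fintype.card {j // j ≤ i ∧ G i j = 1}) x
        (Equiv.arrowCongr e (Equiv.refl Y) y) := fun x =>
    Fintype.prod_equiv e _ _ fun j => by simp
  rw [hprod, hprod]

theorem bhatt_prodChannel {Y : Type} [Fintype Y] {W : ZMod 2 → Y → ℝ}
    (hW : ∀ x y, 0 ≤ W x y) (k : ℕ) : bhatt (prodChannel W k) = bhatt W ^ k := by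
  unfold bhatt prodChannel
  rw [← Fin.prod_const, Fintype.prod_sum]
  refine Finset.sum_congr rfl fun y _ => ?_
  rw [← Finset.prod_mul_distrib,
    Real.sqrt_prod _ fun j _ => mul_nonneg (hW _ _) (hW _ _)]

/-- If `G` is invertible with unit diagonal and not upper triangular, then some
split channel is equivalent to `W^k` for some `k ≥ 2`, in particular its mutual information and
Bhattacharyya parameter are those of `W^k`. -/
theorem exists_splitChannel_eq_prodChannel {Y : Type} [Fintype Y] {l : ℕ}
    (W : ZMod 2 → Y → ℝ) (hW : IsBDMC W) (hsym : IsSymmetricBDMC W)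
    (G : Matrix (Fin l) (Fin l) (ZMod 2)) (hGinv : IsUnit G.det)
    (hdiag : ∀ i, G i i = 1) (hG : ¬ IsUpperTriangular G) :
    ∃ (i : Fin l) (k : ℕ), 2 ≤ k ∧
      mutualInfo (splitChannel W G i) = mutualInfo (prodChannel W k) ∧
      bhatt (splitChannel W G i) = bhatt W ^ k := by
  classical
  unfold IsUpperTriangular at hG
  push Not at hG
  obtain ⟨i₀, j₀, hj₀, hij₀⟩ := hG
  obtain ⟨i, hi, hmax⟩ := (Finset.univ.filter fun r : Fin l => ∃ j < r, G r j ≠ 0).exists_max_image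
    id ⟨i₀, by simpa using ⟨j₀, hj₀, hij₀⟩⟩
  simp only [Finset.mem_filter, Finset.mem_univ, true_and, id] at hi hmax
  obtain ⟨j, hj, hij⟩ := hi
  have hrow : ∀ r, i < r → ∀ j ≤ i, G r j = 0 := by
    intro r hr j hj
    by_contra h
    exact absurd (hmax r ⟨j, hj.trans_lt hr, h⟩) (not_le.2 hr)
  have hij' : G i j = 1 := by
    have hne : ∀ a : ZMod 2, a ≠ 0 → a = 1 := by decide
    exact hne _ hij
  refine ⟨i, Fintype.card {j // j ≤ i ∧ G i j = 1}, ?_, ?_, ?_⟩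
  · refine Fintype.one_lt_card_iff.2
      ⟨⟨j, hj.le, hij'⟩, ⟨i, le_rfl, hdiag i⟩, fun h => hj.ne (congrArg Subtype.val h)⟩
  · have h := sum_splitChannel_eq_sum_prodChannel hW hsym hGinv hrow
      (fun a b => (1 / 2) * a * Real.logb 2 (a / ((1 / 2) * a + (1 / 2) * b)) +
        (1 / 2) * b * Real.logb 2 (b / ((1 / 2) * a + (1 / 2) * b))) ?_
    · simpa only [mutualInfo, ZMod.sum_univ_two] using h
    · intro c a b hc
      rcases hc.eq_or_lt with rfl | hc
      · simp
      · have hden : (1 / 2) * (c * a) + (1 / 2) * (c * b) = c * ((1 / 2) * a + (1 / 2) * b) := by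
          ring
        simp only [hden, mul_div_mul_left _ _ hc.ne']
        ring
  · rw [← bhatt_prodChannel hW.1]
    refine sum_splitChannel_eq_sum_prodChannel hW hsym hGinv hrow
      (fun a b => Real.sqrt (a * b)) fun c a b hc => ?_
    have h : c * a * (c * b) = c ^ 2 * (a * b) := by ring
    simp only [h, Real.sqrt_mul (sq_nonneg c), Real.sqrt_sq hc]
end

section
/- Let W be a symmetric B-DMC and G an invertible ℓ×ℓ matrix over GF(2). Then for every i ∈ {1,…,ℓ} and every fixed u₁^{i−1} ∈ {0,1}^{i−1} there exists a permutation π_{u₁^{i−1}} of 𝒴^ℓ such that W^{(i)}(y₁^ℓ, u₁^{i−1} | u_i) = 2^{−(i−1)} · W̃^{(i)}( π_{u₁^{i−1}}(y₁^ℓ) | u_i ) for all y₁^ℓ ∈ 𝒴^ℓ and u_i ∈ {0,1}. -/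
open scoped BigOperators

/-- The channel `W̃^{(i)}` with past inputs frozen to `0` (here `i : Fin l` is 0-based). -/
noncomputable def tildeChannel {Y : Type} [Fintype Y] {l : ℕ}
    (W : ZMod 2 → Y → ℝ) (G : Matrix (Fin l) (Fin l) (ZMod 2)) (i : Fin l) :
    ZMod 2 → (Fin l → Y) → ℝ :=
  fun ui y =>
    (1 / 2 ^ (l - 1 - i.val)) *
      ∑ u ∈ Finset.univ.filter
          (fun u : Fin l → ZMod 2 => u i = ui ∧ ∀ j : Fin l, j < i → u j = 0),
        ∏ j, W (Matrix.vecMul u G j) (y j)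

/-- For a symmetric channel, translating the input by `c` amounts to permuting the outputs. -/
theorem IsSymmetricBDMC.exists_perm_add {Y : Type} [Fintype Y] {W : ZMod 2 → Y → ℝ}
    (hsym : IsSymmetricBDMC W) (c : ZMod 2) :
    ∃ σ : Equiv.Perm Y, ∀ a y, W (a + c) y = W a (σ y) := by
  obtain ⟨π, hπ, hW⟩ := hsym
  have key : ∀ c : ZMod 2, c = 0 ∨ c = 1 := by decide
  rcases key c with rfl | rfl
  · exact ⟨1, fun a y => by simp⟩
  · refine ⟨hπ.toPerm, fun a y => ?_⟩
    rcases key a with rfl | rfl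
    · simp [hW y]
    · have h : (1 : ZMod 2) + 1 = 0 := by decide
      simp [h, hW (π y), hπ y]

/-- For symmetric `W`, the channels `W^{(i)}` and `W̃^{(i)}` are equivalent:
for every fixed past `u₁^{i-1}` there is a permutation `π` of `𝒴^ℓ` with
`W^{(i)}(y, u₁^{i-1} | u) = 2^{-(i-1)} W̃^{(i)}(π y | u)`. -/
theorem splitChannel_equiv_tildeChannel {Y : Type} [Fintype Y] {l : ℕ}
    (W : ZMod 2 → Y → ℝ) (hW : IsBDMC W) (hsym : IsSymmetricBDMC W)
    (G : Matrix (Fin l) (Fin l) (ZMod 2)) (hGinv : IsUnit G.det)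
    (i : Fin l) (up : Fin i.val → ZMod 2) :
    ∃ π : Equiv.Perm (Fin l → Y),
      ∀ (y : Fin l → Y) (ui : ZMod 2),
        splitChannel W G i ui (y, up) = (1 / 2 ^ i.val) * tildeChannel W G i ui (π y) := by
  choose σ hσ using fun c => hsym.exists_perm_add c
  set v : Fin l → ZMod 2 := fun j => if h : j.val < i.val then up ⟨j.val, h⟩ else 0 with hv
  have v_past : ∀ j : Fin i.val, v (Fin.castLE i.isLt.le j) = up j := fun j =>
    dif_pos j.isLt
  have v_self : v i = 0 := by simp [hv]
  refine ⟨Equiv.piCongrRight fun j => σ (Matrix.vecMul v G j), fun y ui => ?_⟩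
  have hpow : (1 / 2 ^ (l - 1) : ℝ) = 1 / 2 ^ i.val * (1 / 2 ^ (l - 1 - i.val)) := by
    rw [one_div_mul_one_div, ← pow_add, Nat.add_sub_cancel' (by omega)]
  unfold splitChannel tildeChannel
  rw [hpow, mul_assoc]
  congr 2
  refine Finset.sum_equiv (Equiv.subRight v) (fun u => ?_) (fun u _ => ?_)
  · simp only [Finset.mem_filter, Finset.mem_univ, true_and, Equiv.subRight_apply, Pi.sub_apply,
      v_self, sub_zero, sub_eq_zero]
    refine and_congr_right fun _ => ⟨fun h j hj => ?_, fun h j => ?_⟩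
    · exact (h ⟨j.val, hj⟩).trans (v_past ⟨j.val, hj⟩).symm
    · exact (h (Fin.castLE i.isLt.le j) j.isLt).trans (v_past j)
  · refine Finset.prod_congr rfl fun j _ => ?_
    simp only [Equiv.piCongrRight_apply, Pi.map_apply, Equiv.subRight_apply]
    rw [← hσ, ← Pi.add_apply, ← Matrix.add_vecMul, sub_add_cancel]
end

section
/- Let W be a B-DMC and G an invertible ℓ×ℓ matrix over GF(2). Then the split channels W^{(1)},…,W^{(ℓ)} defined from W and G satisfy ∑_{i=1}^{ℓ} I(W^{(i)}) = ℓ · I(W). -/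
open scoped BigOperators

/-- Mutual information as a difference of entropies, in terms of the joint law `V x y / 2`. -/
theorem mutualInfo_mul_log_two {Y : Type} [Fintype Y] (V : ZMod 2 → Y → ℝ)
    (hV : ∀ x y, 0 ≤ V x y) :
    mutualInfo V * Real.log 2 =
      ∑ y, Real.negMulLog (∑ x, 1 / 2 * V x y) - ∑ y, ∑ x, Real.negMulLog (1 / 2 * V x y)
        + Real.log 2 * ∑ y, ∑ x, 1 / 2 * V x y := by
  have hlog : Real.log 2 ≠ 0 := (Real.log_pos one_lt_two).ne'
  have hsum : ∀ y, ∑ x, 1 / 2 * V x y = 1 / 2 * V 0 y + 1 / 2 * V 1 y :=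
    fun y => Fin.sum_univ_two (fun x : ZMod 2 => 1 / 2 * V x y)
  have hterm : ∀ x y, 1 / 2 * V x y *
      Real.logb 2 (V x y / (1 / 2 * V 0 y + 1 / 2 * V 1 y)) * Real.log 2 =
      -(1 / 2 * V x y * Real.log (∑ x, 1 / 2 * V x y)) - Real.negMulLog (1 / 2 * V x y)
        + Real.log 2 * (1 / 2 * V x y) := by
    intro x y
    rw [← hsum, Real.logb, mul_assoc, div_mul_cancel₀ _ hlog]
    rcases (hV x y).eq_or_lt with h | h
    · simp [← h]
    · have hq : 0 < ∑ x, 1 / 2 * V x y :=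
        Finset.sum_pos' (fun x _ => by have := hV x y; positivity)
          ⟨x, Finset.mem_univ x, by positivity⟩
      rw [Real.log_div h.ne' hq.ne', Real.negMulLog, Real.log_mul (by norm_num) h.ne', one_div,
        Real.log_inv]
      ring
  simp only [mutualInfo, Finset.sum_mul, hterm, Finset.sum_add_distrib, Finset.sum_sub_distrib,
    Finset.mul_sum, Finset.sum_neg_distrib]
  simp only [← Finset.mul_sum, ← Finset.sum_mul, Real.negMulLog, neg_mul, Finset.sum_neg_distrib]

theorem sum_prod_eq_one_s5 {A : Type*} [Fintype A] (r : A → ℝ) (hr : ∑ a, r a = 1) (n : ℕ) :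
    ∑ a : Fin n → A, ∏ j, r (a j) = 1 := by
  rw [← Fintype.piFinset_univ, Finset.sum_prod_piFinset]
  simp [hr]

/-- Additivity of entropy over a product of copies of a probability distribution. -/
theorem sum_negMulLog_prod {A : Type*} [Fintype A] (r : A → ℝ) (hr : ∑ a, r a = 1) (n : ℕ) :
    ∑ a : Fin n → A, Real.negMulLog (∏ j, r (a j)) = n * ∑ a, Real.negMulLog (r a) := by
  induction n with
  | zero => simp
  | succ n ih =>
    rw [← (Fin.consEquiv fun _ : Fin (n + 1) => A).sum_comp, Fintype.sum_prod_type]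
    simp only [Fin.consEquiv_apply, Fin.prod_univ_succ, Fin.cons_zero, Fin.cons_succ,
      Real.negMulLog_mul, Finset.sum_add_distrib]
    simp only [← Finset.mul_sum, ← Finset.sum_mul, ih, sum_prod_eq_one_s5 r hr, hr]
    push_cast
    ring

/-- The sum of `f` over all words whose first `k` letters agree with `v`. -/
noncomputable def prefixMarginal {l : ℕ} (f : (Fin l → ZMod 2) → ℝ) (k : ℕ)
    (v : Fin k → ZMod 2) : ℝ :=
  ∑ u with ∀ (j : Fin l) (h : j.1 < k), u j = v ⟨j, h⟩, f u

theorem prefixMarginal_zero {l : ℕ} (f : (Fin l → ZMod 2) → ℝ) (v : Fin 0 → ZMod 2) :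
    prefixMarginal f 0 v = ∑ u, f u := by
  simp [prefixMarginal]

theorem prefixMarginal_self {l : ℕ} (f : (Fin l → ZMod 2) → ℝ) (v : Fin l → ZMod 2) :
    prefixMarginal f l v = f v := by
  simp [prefixMarginal, ← funext_iff, Finset.filter_eq']

theorem agree_snoc_iff {l : ℕ} (i : Fin l) (u : Fin l → ZMod 2) (v : Fin i.1 → ZMod 2)
    (x : ZMod 2) :
    (∀ (j : Fin l) (h : j.1 < i.1 + 1),
        u j = (Fin.snoc v x : Fin (i.1 + 1) → ZMod 2) ⟨j, h⟩) ↔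
      u i = x ∧ ∀ (j : Fin l) (h : j.1 < i.1), u j = v ⟨j, h⟩ := by
  constructor
  · intro H
    refine ⟨by simpa [Fin.snoc] using H i (Nat.lt_succ_self _), fun j h => ?_⟩
    simpa [Fin.snoc, h] using H j (h.trans (Nat.lt_succ_self _))
  · rintro ⟨hx, hv⟩ j h
    by_cases hj : j.1 < i.1
    · simpa [Fin.snoc, hj] using hv j hj
    · obtain rfl : j = i := Fin.ext (by omega)
      simpa [Fin.snoc] using hx

theorem sum_prefixMarginal_snoc {l : ℕ} (f : (Fin l → ZMod 2) → ℝ) (i : Fin l)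
    (v : Fin i.1 → ZMod 2) :
    ∑ x : ZMod 2, prefixMarginal f (i.1 + 1) (Fin.snoc v x) = prefixMarginal f i.1 v := by
  simp only [prefixMarginal, agree_snoc_iff]
  rw [← Finset.sum_fiberwise _ (fun u => u i) f]
  refine Finset.sum_congr rfl fun x _ => ?_
  rw [Finset.filter_filter]
  simp only [and_comm]

theorem sum_snoc {A M : Type*} [Fintype A] [AddCommMonoid M] (k : ℕ)
    (g : (Fin (k + 1) → A) → M) :
    ∑ w, g w = ∑ v : Fin k → A, ∑ x, g (Fin.snoc v x) := by
  rw [← (Fin.snocEquiv fun _ : Fin (k + 1) => A).sum_comp, Fintype.sum_prod_type_right]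
  rfl

theorem sum_prefixMarginal {l : ℕ} (f : (Fin l → ZMod 2) → ℝ) (k : ℕ) (hk : k ≤ l) :
    ∑ v, prefixMarginal f k v = ∑ u, f u := by
  induction k with
  | zero => simp [prefixMarginal_zero]
  | succ k ih =>
    rw [sum_snoc, ← ih (by omega)]
    exact Finset.sum_congr rfl fun v _ => sum_prefixMarginal_snoc f ⟨k, hk⟩ v

/-- The joint law of uniform inputs `u` and outputs `y` of `m` uses of `W` precoded by `G`. -/
noncomputable def jointLaw {Y : Type} {m : ℕ} (W : ZMod 2 → Y → ℝ)
    (G : Matrix (Fin m) (Fin m) (ZMod 2)) (y : Fin m → Y) (u : Fin m → ZMod 2) : ℝ :=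
  ∏ j, 1 / 2 * W (Matrix.vecMul u G j) (y j)

theorem half_mul_splitChannel {Y : Type} [Fintype Y] {m : ℕ} (W : ZMod 2 → Y → ℝ)
    (G : Matrix (Fin m) (Fin m) (ZMod 2)) (i : Fin m) (x : ZMod 2) (y : Fin m → Y)
    (v : Fin i.1 → ZMod 2) :
    1 / 2 * splitChannel W G i x (y, v) =
      prefixMarginal (jointLaw W G y) (i.1 + 1) (Fin.snoc v x) := by
  have hpow : (1 / 2 : ℝ) * (1 / 2 ^ (m - 1)) = (1 / 2) ^ m := by
    obtain ⟨n, rfl⟩ : ∃ n, m = n + 1 := ⟨m - 1, by have := i.2; omega⟩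
    simp [pow_succ, mul_comm]
  simp only [splitChannel, prefixMarginal, agree_snoc_iff, jointLaw, Finset.prod_mul_distrib,
    Finset.prod_const, Finset.card_univ, Fintype.card_fin]
  rw [← mul_assoc, hpow, Finset.mul_sum]
  refine Finset.sum_congr (Finset.filter_congr fun u _ => and_congr_right fun _ => ?_)
    fun _ _ => rfl
  exact ⟨fun H j h => H ⟨j, h⟩, fun H j => H _ j.2⟩

theorem sum_vecMul {m : ℕ} {M : Type*} [AddCommMonoid M] (G : Matrix (Fin m) (Fin m) (ZMod 2))
    (hG : IsUnit G.det) (g : (Fin m → ZMod 2) → M) :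
    ∑ u, g (Matrix.vecMul u G) = ∑ u, g u :=
  (Function.Injective.bijective_of_finite (Matrix.vecMul_injective_of_isUnit
    ((Matrix.isUnit_iff_isUnit_det G).2 hG))).sum_comp g

theorem sum_jointLaw {Y : Type} {m : ℕ} (W : ZMod 2 → Y → ℝ)
    (G : Matrix (Fin m) (Fin m) (ZMod 2)) (hG : IsUnit G.det) (y : Fin m → Y) :
    ∑ u, jointLaw W G y u = ∏ j, ∑ x, 1 / 2 * W x (y j) := by
  simp only [jointLaw]
  rw [sum_vecMul G hG fun x => ∏ j, 1 / 2 * W (x j) (y j), Finset.prod_univ_sum,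
    Fintype.piFinset_univ]

/-- The chain rule increment: `I(W^{(i)})` is a difference of prefix entropies. -/
theorem mutualInfo_splitChannel_mul_log_two {Y : Type} [Fintype Y] {m : ℕ} (W : ZMod 2 → Y → ℝ)
    (hW : ∀ x y, 0 ≤ W x y) (G : Matrix (Fin m) (Fin m) (ZMod 2)) (i : Fin m) :
    mutualInfo (splitChannel W G i) * Real.log 2 =
      ∑ y, ∑ v, Real.negMulLog (prefixMarginal (jointLaw W G y) i.1 v)
        - ∑ y, ∑ v, Real.negMulLog (prefixMarginal (jointLaw W G y) (i.1 + 1) v)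
        + Real.log 2 * ∑ y, ∑ u, jointLaw W G y u := by
  rw [mutualInfo_mul_log_two]
  · simp only [Fintype.sum_prod_type, half_mul_splitChannel, sum_prefixMarginal_snoc, sum_snoc,
      sum_prefixMarginal _ _ i.2.le]
  · intro x z
    exact mul_nonneg (by positivity)
      (Finset.sum_nonneg fun u _ => Finset.prod_nonneg fun j _ => hW _ _)

/-- The split channels of any invertible `G` preserve total mutual
information: `∑ i, I(W^{(i)}) = ℓ · I(W)`. -/
theorem sum_mutualInfo_splitChannel {Y : Type} [Fintype Y] {l : ℕ}
    (W : ZMod 2 → Y → ℝ) (hW : IsBDMC W)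
    (G : Matrix (Fin l) (Fin l) (ZMod 2)) (hGinv : IsUnit G.det) :
    ∑ i : Fin l, mutualInfo (splitChannel W G i) = l * mutualInfo W := by
  obtain ⟨hnonneg, hsum⟩ := hW
  refine mul_right_cancel₀ (Real.log_pos one_lt_two).ne' ?_
  have htotal : ∑ y, ∑ x, 1 / 2 * W x y = 1 := by
    rw [Finset.sum_comm]
    simp [← Finset.mul_sum, hsum]
  have hjoint : ∑ y, ∑ u, jointLaw W G y u = 1 := by
    simp only [sum_jointLaw W G hGinv]
    exact sum_prod_eq_one_s5 (fun y => ∑ x, 1 / 2 * W x y) htotal l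
  have houtput : ∑ y, Real.negMulLog (∑ u, jointLaw W G y u) =
      l * ∑ y, Real.negMulLog (∑ x, 1 / 2 * W x y) := by
    simp only [sum_jointLaw W G hGinv]
    exact sum_negMulLog_prod (fun y => ∑ x, 1 / 2 * W x y) htotal l
  have hpair : ∑ y, ∑ u, Real.negMulLog (jointLaw W G y u) =
      l * ∑ y, ∑ x, Real.negMulLog (1 / 2 * W x y) := by
    simp only [jointLaw]
    have h := sum_negMulLog_prod (fun a : Y × ZMod 2 => 1 / 2 * W a.2 a.1)
      (by rw [Fintype.sum_prod_type]; exact htotal) l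
    rw [Fintype.sum_prod_type] at h
    rw [← h, ← (Equiv.arrowProdEquivProdArrow (Fin l) (fun _ => Y) fun _ => ZMod 2).symm.sum_comp,
      Fintype.sum_prod_type]
    refine Finset.sum_congr rfl fun y _ => ?_
    exact sum_vecMul G hGinv fun x => Real.negMulLog (∏ j, 1 / 2 * W (x j) (y j))
  rw [Finset.sum_mul, mul_assoc, mutualInfo_mul_log_two W hnonneg, htotal]
  simp only [mutualInfo_splitChannel_mul_log_two W hnonneg, hjoint, Finset.sum_add_distrib]
  rw [Fin.sum_univ_eq_sum_range (fun k =>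
    ∑ y, ∑ v, Real.negMulLog (prefixMarginal (jointLaw W G y) k v)
      - ∑ y, ∑ v, Real.negMulLog (prefixMarginal (jointLaw W G y) (k + 1) v)),
    Finset.sum_range_sub']
  simp only [prefixMarginal_zero, prefixMarginal_self, houtput, hpair, Finset.sum_const,
    Finset.card_univ, Fintype.card_fin, Fintype.card_unique, one_smul, nsmul_eq_mul]
  ring
end

section
/- Let W be a symmetric B-DMC and G a polarizing ℓ×ℓ matrix over GF(2). Then for every i ∈ {1,…,ℓ}, the split channel W^{(i)} defined from W and G satisfies Z(W^{(i)}) ≤ ℓ · Z(W). -/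
open scoped BigOperators

/-- The nontrivial additive character of `ZMod 2`, with real values. -/
def zmodTwoSign (a : ZMod 2) : ℝ := if a = 0 then 1 else -1

theorem zmodTwoSign_add (a b : ZMod 2) :
    zmodTwoSign (a + b) = zmodTwoSign a * zmodTwoSign b := by
  have cases : ∀ a : ZMod 2, a = 0 ∨ a = 1 := by decide
  rcases cases a with rfl | rfl <;> rcases cases b with rfl | rfl <;>
    simp [zmodTwoSign, show (1 + 1 : ZMod 2) = 0 from rfl]

theorem zmodTwoSign_sum {ι : Type*} (t : Finset ι) (f : ι → ZMod 2) :
    zmodTwoSign (∑ j ∈ t, f j) = ∏ j ∈ t, zmodTwoSign (f j) := by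
  classical
  induction t using Finset.induction_on with
  | empty => simp [zmodTwoSign]
  | insert a t ha ih => rw [Finset.sum_insert ha, Finset.prod_insert ha, zmodTwoSign_add, ih]

theorem sqrt_add_le_sqrt_add_sqrt {x y : ℝ} (hx : 0 ≤ x) (hy : 0 ≤ y) :
    √(x + y) ≤ √x + √y := by
  rw [Real.sqrt_le_left (by positivity), add_sq, Real.sq_sqrt hx, Real.sq_sqrt hy]
  have : 0 ≤ √x * √y := by positivity
  linarith

/-- A union bound for the square root of a difference of products of squares. -/
theorem sqrt_prod_sq_sub_prod_sq_le {ι : Type*} [DecidableEq ι] (t : Finset ι)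
    (s e r : ι → ℝ) (hs : ∀ j, 0 ≤ s j) (hr : ∀ j, 0 ≤ r j) (hes : ∀ j, e j ^ 2 ≤ s j ^ 2)
    (hser : ∀ j, s j ^ 2 - e j ^ 2 ≤ r j ^ 2) :
    √((∏ j ∈ t, s j) ^ 2 - (∏ j ∈ t, e j) ^ 2) ≤
      ∑ j ∈ t, ∏ k ∈ t, if k = j then r k else s k := by
  induction t using Finset.induction_on with
  | empty => simp
  | insert a t ha ih =>
    have hrec : ∑ j ∈ insert a t, ∏ k ∈ insert a t, (if k = j then r k else s k) =
        r a * (∏ k ∈ t, s k) + s a * ∑ j ∈ t, ∏ k ∈ t, if k = j then r k else s k := by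
      rw [Finset.sum_insert ha, Finset.mul_sum, Finset.prod_insert ha, if_pos rfl]
      congr 1
      · congr 1
        refine Finset.prod_congr rfl fun k hk => if_neg ?_
        rintro rfl
        exact ha hk
      · refine Finset.sum_congr rfl fun j hj => ?_
        rw [Finset.prod_insert ha, if_neg]
        rintro rfl
        exact ha hj
    rw [hrec, Finset.prod_insert ha, Finset.prod_insert ha]
    set S := ∏ k ∈ t, s k
    set E := ∏ k ∈ t, e k
    have hS : 0 ≤ S := Finset.prod_nonneg fun k _ => hs k
    have hES : E ^ 2 ≤ S ^ 2 := by
      simp only [S, E, ← Finset.prod_pow]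
      exact Finset.prod_le_prod (fun k _ => sq_nonneg _) fun k _ => hes k
    calc √((s a * S) ^ 2 - (e a * E) ^ 2)
        ≤ √((r a * S) ^ 2 + s a ^ 2 * (S ^ 2 - E ^ 2)) := by
          apply Real.sqrt_le_sqrt
          nlinarith [mul_le_mul_of_nonneg_right (hser a) (sq_nonneg S),
            mul_le_mul_of_nonneg_right (hes a) (sub_nonneg.2 hES)]
      _ ≤ √((r a * S) ^ 2) + √(s a ^ 2 * (S ^ 2 - E ^ 2)) :=
          sqrt_add_le_sqrt_add_sqrt (sq_nonneg _) (mul_nonneg (sq_nonneg _) (sub_nonneg.2 hES))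
      _ = r a * S + s a * √(S ^ 2 - E ^ 2) := by
          rw [Real.sqrt_sq (mul_nonneg (hr a) hS), Real.sqrt_mul (sq_nonneg _),
            Real.sqrt_sq (hs a)]
      _ ≤ _ := by gcongr; exact hs a

theorem sum_zmodTwo (f : ZMod 2 → ℝ) : ∑ a, f a = f 0 + f 1 := Fin.sum_univ_two f

theorem sum_prod_eq_prod_sum {ι α : Type*} [Fintype ι] [DecidableEq ι] [Fintype α]
    (f : ι → α → ℝ) : ∑ x : ι → α, ∏ j, f j (x j) = ∏ j, ∑ a, f j a := by
  rw [Finset.prod_univ_sum, Fintype.piFinset_univ]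

theorem sum_comp_vecMul {l : ℕ} {G : Matrix (Fin l) (Fin l) (ZMod 2)} (hG : IsUnit G.det)
    (f : (Fin l → ZMod 2) → (Fin l → ZMod 2) → ℝ) :
    ∑ u, f u (Matrix.vecMul u G) = ∑ x, f (Matrix.vecMul x G⁻¹) x := by
  let φ : (Fin l → ZMod 2) ≃ (Fin l → ZMod 2) :=
    { toFun := fun u => Matrix.vecMul u G
      invFun := fun x => Matrix.vecMul x G⁻¹
      left_inv := fun u => by simp [Matrix.mul_nonsing_inv G hG]
      right_inv := fun x => by simp [Matrix.nonsing_inv_mul G hG] }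
  refine Fintype.sum_equiv φ _ _ fun u => ?_
  change _ = f (φ.symm (φ u)) (φ u)
  rw [φ.symm_apply_apply]
  rfl

theorem splitChannel_nonneg {Y : Type} [Fintype Y] {m : ℕ} {W : ZMod 2 → Y → ℝ}
    (hW : ∀ x y, 0 ≤ W x y) (G : Matrix (Fin m) (Fin m) (ZMod 2)) (i : Fin m) (a : ZMod 2)
    (z : (Fin m → Y) × (Fin i.val → ZMod 2)) : 0 ≤ splitChannel W G i a z :=
  mul_nonneg (by positivity) (Finset.sum_nonneg fun _ _ => Finset.prod_nonneg fun _ _ => hW _ _)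

/-- Summing out the known past of a split channel. -/
theorem sum_splitChannel {Y : Type} [Fintype Y] {m : ℕ} (W : ZMod 2 → Y → ℝ)
    (G : Matrix (Fin m) (Fin m) (ZMod 2)) (i : Fin m) (a : ZMod 2) (y : Fin m → Y) :
    ∑ z, splitChannel W G i a (y, z) =
      (1 / 2 ^ (m - 1)) * ∑ u : Fin m → ZMod 2,
        if u i = a then ∏ j, W (Matrix.vecMul u G j) (y j) else 0 := by
  simp only [splitChannel, ← Finset.mul_sum]
  congr 1
  rw [← Finset.sum_filter,
    ← Finset.sum_fiberwise _ fun (u : Fin m → ZMod 2) (j : Fin i.val) => u (Fin.castLE i.isLt.le j)]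
  refine Finset.sum_congr rfl fun z _ => ?_
  rw [Finset.filter_filter]
  simp only [funext_iff]

/-- The product of the two likelihoods of a split channel with its past summed out. -/
theorem sum_splitChannel_mul {Y : Type} [Fintype Y] {l : ℕ} (W : ZMod 2 → Y → ℝ)
    {G : Matrix (Fin l) (Fin l) (ZMod 2)} (hG : IsUnit G.det) (i : Fin l) (y : Fin l → Y) :
    (∑ z, splitChannel W G i 0 (y, z)) * (∑ z, splitChannel W G i 1 (y, z)) =
      (∏ j, (W 0 (y j) + W 1 (y j)) / 2) ^ 2 -
        (∏ j, (W 0 (y j) + zmodTwoSign (G⁻¹ j i) * W 1 (y j)) / 2) ^ 2 := by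
  rw [sum_splitChannel, sum_splitChannel]
  set Q : ZMod 2 → ℝ := fun a => ∑ u : Fin l → ZMod 2,
    if u i = a then ∏ j, W (Matrix.vecMul u G j) (y j) else 0 with hQ
  have hadd : Q 0 + Q 1 = ∏ j, (W 0 (y j) + W 1 (y j)) := by
    calc Q 0 + Q 1 = ∑ u : Fin l → ZMod 2, ∏ j, W (Matrix.vecMul u G j) (y j) := by
          simp only [hQ, ← Finset.sum_add_distrib]
          refine Finset.sum_congr rfl fun u _ => ?_
          rcases (by decide : ∀ a : ZMod 2, a = 0 ∨ a = 1) (u i) with h | h <;> simp [h]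
      _ = ∑ x : Fin l → ZMod 2, ∏ j, W (x j) (y j) :=
          sum_comp_vecMul hG fun _ x => ∏ j, W (x j) (y j)
      _ = _ := by
          rw [sum_prod_eq_prod_sum fun j a => W a (y j)]
          simp only [sum_zmodTwo]
  have hsub : Q 0 - Q 1 = ∏ j, (W 0 (y j) + zmodTwoSign (G⁻¹ j i) * W 1 (y j)) := by
    calc Q 0 - Q 1
        = ∑ u : Fin l → ZMod 2, zmodTwoSign (u i) * ∏ j, W (Matrix.vecMul u G j) (y j) := by
          simp only [hQ, ← Finset.sum_sub_distrib]
          refine Finset.sum_congr rfl fun u _ => ?_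
          rcases (by decide : ∀ a : ZMod 2, a = 0 ∨ a = 1) (u i) with h | h <;>
            simp [h, zmodTwoSign]
      _ = ∑ x : Fin l → ZMod 2,
            zmodTwoSign (Matrix.vecMul x G⁻¹ i) * ∏ j, W (x j) (y j) :=
          sum_comp_vecMul hG fun u x => zmodTwoSign (u i) * ∏ j, W (x j) (y j)
      _ = ∑ x : Fin l → ZMod 2, ∏ j, zmodTwoSign (x j * G⁻¹ j i) * W (x j) (y j) := by
          refine Finset.sum_congr rfl fun x _ => ?_
          rw [Finset.prod_mul_distrib, ← zmodTwoSign_sum]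
          rfl
      _ = _ := by
          rw [sum_prod_eq_prod_sum fun j a => zmodTwoSign (a * G⁻¹ j i) * W a (y j)]
          simp only [sum_zmodTwo, zero_mul, one_mul]
          simp [zmodTwoSign]
  simp only [Finset.prod_div_distrib, Finset.prod_const, Finset.card_univ, Fintype.card_fin]
  rw [← hadd, ← hsub]
  obtain ⟨n, rfl⟩ : ∃ n, l = n + 1 := ⟨l - 1, by have := i.isLt; omega⟩
  change 1 / 2 ^ (n + 1 - 1) * Q 0 * (1 / 2 ^ (n + 1 - 1) * Q 1) = _
  rw [Nat.add_sub_cancel, pow_succ]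
  field_simp
  ring

/-- For symmetric `W` and polarizing `G`, every split channel satisfies
`Z(W^{(i)}) ≤ ℓ · Z(W)`. -/
theorem bhatt_splitChannel_le {Y : Type} [Fintype Y] {l : ℕ}
    (W : ZMod 2 → Y → ℝ) (hW : IsBDMC W) (hsym : IsSymmetricBDMC W)
    (G : Matrix (Fin l) (Fin l) (ZMod 2)) (hG : IsPolarizing G) (i : Fin l) :
    bhatt (splitChannel W G i) ≤ l * bhatt W := by
  obtain ⟨hnn, hsum⟩ := hW
  set s : Y → ℝ := fun b => (W 0 b + W 1 b) / 2
  set r : Y → ℝ := fun b => √(W 0 b * W 1 b)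
  have hs : ∑ b, s b = 1 := by
    simp only [s, ← Finset.sum_div, Finset.sum_add_distrib, hsum]
    norm_num
  have hr (b : Y) : r b ^ 2 = W 0 b * W 1 b := Real.sq_sqrt (mul_nonneg (hnn _ _) (hnn _ _))
  have hpoint (y : Fin l → Y) :
      ∑ z, √(splitChannel W G i 0 (y, z) * splitChannel W G i 1 (y, z)) ≤
        ∑ j, ∏ k, if k = j then r (y k) else s (y k) := by
    have hP := splitChannel_nonneg hnn G i
    calc _ = ∑ z, √(splitChannel W G i 0 (y, z)) * √(splitChannel W G i 1 (y, z)) :=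
          Finset.sum_congr rfl fun z _ => Real.sqrt_mul (hP 0 _) _
      _ ≤ √(∑ z, splitChannel W G i 0 (y, z)) * √(∑ z, splitChannel W G i 1 (y, z)) :=
          Real.sum_sqrt_mul_sqrt_le _ (fun _ => hP 0 _) fun _ => hP 1 _
      _ = √((∏ j, s (y j)) ^ 2 -
            (∏ j, (W 0 (y j) + zmodTwoSign (G⁻¹ j i) * W 1 (y j)) / 2) ^ 2) := by
          rw [← Real.sqrt_mul (Finset.sum_nonneg fun _ _ => hP 0 _),
            sum_splitChannel_mul W hG.1 i y]
      _ ≤ _ := by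
          apply sqrt_prod_sq_sub_prod_sq_le
          · exact fun j => div_nonneg (add_nonneg (hnn _ _) (hnn _ _)) zero_le_two
          · exact fun j => Real.sqrt_nonneg _
          · intro j
            have := mul_nonneg (hnn 0 (y j)) (hnn 1 (y j))
            by_cases h : G⁻¹ j i = 0 <;> simp only [s, zmodTwoSign, h, if_true, if_false] <;>
              nlinarith
          · intro j
            have := mul_nonneg (hnn 0 (y j)) (hnn 1 (y j))
            rw [hr]
            by_cases h : G⁻¹ j i = 0 <;> simp only [s, zmodTwoSign, h, if_true, if_false] <;>
              nlinarith
  calc bhatt (splitChannel W G i)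
      = ∑ y, ∑ z, √(splitChannel W G i 0 (y, z) * splitChannel W G i 1 (y, z)) :=
        Fintype.sum_prod_type _
    _ ≤ ∑ y : Fin l → Y, ∑ j, ∏ k, if k = j then r (y k) else s (y k) :=
        Finset.sum_le_sum fun y _ => hpoint y
    _ = ∑ j : Fin l, ∑ y : Fin l → Y, ∏ k, if k = j then r (y k) else s (y k) :=
        Finset.sum_comm
    _ = ∑ _j : Fin l, bhatt W := by
        refine Finset.sum_congr rfl fun j _ => ?_
        rw [sum_prod_eq_prod_sum fun k b => if k = j then r b else s b,
          Finset.prod_eq_single j (fun k _ hk => by simpa [hk] using hs) (by simp)]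
        simp [r, bhatt]
    _ = l * bhatt W := by simp
end

section
/- For every δ > 0 there exists η(δ) > 0 such that for every symmetric B-DMC W with I(W) ∈ (δ, 1−δ) and every integer k ≥ 2, one has I(W^k) − I(W) > η(δ). -/
open scoped BigOperators

open Real

/-- The contribution of one output letter to the mutual information, in nats. -/
noncomputable def infoTerm (a b : ℝ) : ℝ :=
  negMulLog ((a + b) / 2) - negMulLog a / 2 - negMulLog b / 2

lemma infoTerm_comm (a b : ℝ) : infoTerm a b = infoTerm b a := by
  unfold infoTerm
  rw [add_comm a b]
  ring

lemma infoTerm_nonneg {a b : ℝ} (ha : 0 ≤ a) (hb : 0 ≤ b) : 0 ≤ infoTerm a b := by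
  have h := concaveOn_negMulLog.2 (Set.mem_Ici.2 ha) (Set.mem_Ici.2 hb)
    (by norm_num : (0 : ℝ) ≤ 1 / 2) (by norm_num : (0 : ℝ) ≤ 1 / 2) (by norm_num)
  simp only [smul_eq_mul] at h
  rw [show 1 / 2 * a + 1 / 2 * b = (a + b) / 2 by ring] at h
  unfold infoTerm
  linarith

lemma mul_log_div_eq {x m : ℝ} (h : m = 0 → x = 0) :
    x * log (x / m) = -negMulLog x - x * log m := by
  unfold negMulLog
  rcases eq_or_ne x 0 with rfl | hx
  · simp
  · rw [log_div hx (mt h hx)]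
    ring

lemma mutualInfo_mul_log_two_s12 {Y : Type} [Fintype Y] {W : ZMod 2 → Y → ℝ}
    (hW : ∀ x y, 0 ≤ W x y) :
    mutualInfo W * log 2 = ∑ y, infoTerm (W 0 y) (W 1 y) := by
  unfold mutualInfo
  rw [Finset.sum_mul]
  refine Finset.sum_congr rfl fun y _ => ?_
  have h0 := hW 0 y
  have h1 := hW 1 y
  have hl : log 2 ≠ 0 := (log_pos one_lt_two).ne'
  rw [show (∑ x : ZMod 2, (1 / 2) * W x y *
      logb 2 (W x y / ((1 / 2) * W 0 y + (1 / 2) * W 1 y)))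
      = (1 / 2) * W 0 y * logb 2 (W 0 y / ((1 / 2) * W 0 y + (1 / 2) * W 1 y))
      + (1 / 2) * W 1 y * logb 2 (W 1 y / ((1 / 2) * W 0 y + (1 / 2) * W 1 y)) from
    Fin.sum_univ_two _]
  set m := (1 / 2) * W 0 y + (1 / 2) * W 1 y with hm
  have e0 := mul_log_div_eq (x := W 0 y) (m := m) (fun h => by linarith)
  have e1 := mul_log_div_eq (x := W 1 y) (m := m) (fun h => by linarith)
  have hN : negMulLog m = -m * log m := rfl
  rw [infoTerm, show (W 0 y + W 1 y) / 2 = m by rw [hm]; ring, hN]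
  unfold logb
  field_simp
  linear_combination e0 + e1 + (-2 * log m) * hm

/-- One use of a channel with output laws `c`, `d`, seen after an observation of likelihoods
`a`, `b`, yields at least `min a b` times its mutual information under the uniform input. -/
lemma infoTerm_add_le_sum {Z : Type} [Fintype Z] {c d : Z → ℝ} (hc : ∀ z, 0 ≤ c z)
    (hd : ∀ z, 0 ≤ d z) (hc1 : ∑ z, c z = 1) (hd1 : ∑ z, d z = 1) {a b : ℝ} (ha : 0 ≤ a)
    (hab : a ≤ b) :
    infoTerm a b + a * ∑ z, infoTerm (c z) (d z) ≤ ∑ z, infoTerm (a * c z) (b * d z) := by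
  rcases (add_nonneg ha (ha.trans hab)).eq_or_lt with h | hT
  · obtain rfl : a = 0 := by linarith
    obtain rfl : b = 0 := by linarith
    simp [infoTerm]
  set T := (a + b) / 2 with hTdef
  have hT0 : 0 < T := by linarith
  have key : ∀ z, infoTerm a b * d z
      + (a / 2 * (c z - d z)) / T * negMulLog T + negMulLog a / 2 * (d z - c z)
      + a * infoTerm (c z) (d z) ≤ infoTerm (a * c z) (b * d z) := by
    intro z
    have hcz := hc z
    have hdz := hd z
    have h := concaveOn_negMulLog.2 (Set.mem_Ici.2 (by positivity : 0 ≤ (c z + d z) / 2))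
      (Set.mem_Ici.2 hdz) (by positivity : 0 ≤ a / T)
      (div_nonneg (by linarith) hT0.le : 0 ≤ (b - a) / 2 / T) (by rw [← add_div, div_eq_one_iff_eq hT0.ne', hTdef]; ring)
    simp only [smul_eq_mul] at h
    set m := a / T * ((c z + d z) / 2) + (b - a) / 2 / T * d z with hm
    have hTm : (a * c z + b * d z) / 2 = T * m := by
      rw [hm]
      field_simp
      ring
    have hmul := mul_le_mul_of_nonneg_left h hT0.le
    have e : T * (a / T * negMulLog ((c z + d z) / 2) + (b - a) / 2 / T * negMulLog (d z))
        = a * negMulLog ((c z + d z) / 2) + (b - a) / 2 * negMulLog (d z) := by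
      field_simp
    have hm' : m = d z + (a / 2 * (c z - d z)) / T := by
      rw [hm]
      field_simp
      rw [hTdef]
      ring
    rw [e] at hmul
    unfold infoTerm
    rw [hTm, negMulLog_mul T m, negMulLog_mul a, negMulLog_mul b, ← hTdef]
    have hm2 : m * negMulLog T = d z * negMulLog T + (a / 2 * (c z - d z)) / T * negMulLog T := by
      rw [hm']
      ring
    rw [hm2]
    linarith
  have hsum := Finset.sum_le_sum fun z (_ : z ∈ Finset.univ) => key z
  simp only [Finset.sum_add_distrib, ← Finset.mul_sum, ← Finset.sum_mul, ← Finset.sum_div,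
    Finset.sum_sub_distrib, hc1, hd1] at hsum
  simpa using hsum

lemma infoTerm_add_min_mul_le_sum {Z : Type} [Fintype Z] {c d : Z → ℝ} (hc : ∀ z, 0 ≤ c z)
    (hd : ∀ z, 0 ≤ d z) (hc1 : ∑ z, c z = 1) (hd1 : ∑ z, d z = 1) {a b : ℝ} (ha : 0 ≤ a)
    (hb : 0 ≤ b) :
    infoTerm a b + min a b * ∑ z, infoTerm (c z) (d z) ≤ ∑ z, infoTerm (a * c z) (b * d z) := by
  rcases le_total a b with h | h
  · rw [min_eq_left h]
    exact infoTerm_add_le_sum hc hd hc1 hd1 ha h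
  · rw [min_eq_right h]
    simpa only [infoTerm_comm] using infoTerm_add_le_sum hd hc hd1 hc1 hb h

lemma negMulLog_add_negMulLog_one_sub_le_two_mul_sqrt {p : ℝ} (hp : 0 ≤ p) (hp1 : p < 1) :
    negMulLog p + negMulLog (1 - p) ≤ 2 * √p := by
  have h1 : negMulLog (1 - p) ≤ p := by
    have hlog := one_sub_inv_le_log_of_pos (sub_pos.2 hp1)
    have hmul := mul_le_mul_of_nonneg_left hlog (sub_pos.2 hp1).le
    rw [mul_sub, mul_inv_cancel₀ (sub_pos.2 hp1).ne'] at hmul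
    unfold negMulLog
    linarith
  rcases hp.eq_or_lt with rfl | hp0
  · simp
  have hs : 0 < √p := sqrt_pos.2 hp0
  have hps : √p * √p = p := mul_self_sqrt hp
  have h2 : negMulLog p ≤ 2 * √p - 2 * p := by
    have hlog := one_sub_inv_le_log_of_pos hs
    rw [log_sqrt hp] at hlog
    have hmul := mul_le_mul_of_nonneg_left hlog hp
    have hinv : p * (√p)⁻¹ = √p := by
      rw [← div_eq_mul_inv, div_sqrt]
    rw [mul_sub, hinv] at hmul
    unfold negMulLog
    linarith
  linarith

lemma mean_mul_log_two_sub_infoTerm_le_of_le {a b ε : ℝ} (ha : 0 ≤ a) (hab : a ≤ b)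
    (hε : 0 < ε) :
    (a + b) / 2 * log 2 - infoTerm a b ≤ ε * ((a + b) / 2) + a / (2 * ε) := by
  rcases (add_nonneg ha (ha.trans hab)).eq_or_lt with h | hT
  · obtain rfl : a = 0 := by linarith
    obtain rfl : b = 0 := by linarith
    simp [infoTerm]
  set T := (a + b) / 2 with hTdef
  have hT0 : 0 < T := by linarith
  set p := a / (2 * T) with hp
  have hpa : a = (2 * T) * p := by
    rw [hp]
    field_simp
  have hpb : b = (2 * T) * (1 - p) := by
    rw [mul_sub, ← hpa, hTdef]
    ring
  have hp0 : 0 ≤ p := by positivity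
  have hp1 : p < 1 := by
    rw [hp, div_lt_one (by positivity)]
    linarith
  have hN2 : negMulLog 2 = -2 * log 2 := rfl
  have hterm : T * log 2 - infoTerm a b = T * (negMulLog p + negMulLog (1 - p)) := by
    have hA : negMulLog a = p * negMulLog (2 * T) + 2 * T * negMulLog p := by
      rw [← negMulLog_mul, ← hpa]
    have hB : negMulLog b = (1 - p) * negMulLog (2 * T) + 2 * T * negMulLog (1 - p) := by
      rw [← negMulLog_mul, ← hpb]
    unfold infoTerm
    rw [← hTdef, hA, hB, negMulLog_mul 2 T, hN2]
    ring
  have hsq : 2 * √p ≤ ε + p / ε := by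
    have hs : √p ^ 2 = p := sq_sqrt hp0
    have : ε + p / ε - 2 * √p = (ε - √p) ^ 2 / ε := by
      field_simp
      rw [← hs, sqrt_sq (sqrt_nonneg p)]
      ring
    have : 0 ≤ (ε - √p) ^ 2 / ε := by positivity
    linarith
  rw [hterm]
  calc T * (negMulLog p + negMulLog (1 - p)) ≤ T * (ε + p / ε) :=
        mul_le_mul_of_nonneg_left ((negMulLog_add_negMulLog_one_sub_le_two_mul_sqrt hp0 hp1).trans hsq) hT0.le
    _ = ε * T + a / (2 * ε) := by
        rw [hp]
        field_simp

lemma mean_mul_log_two_sub_infoTerm_le {a b ε : ℝ} (ha : 0 ≤ a) (hb : 0 ≤ b) (hε : 0 < ε) :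
    (a + b) / 2 * log 2 - infoTerm a b ≤ ε * ((a + b) / 2) + min a b / (2 * ε) := by
  rcases le_total a b with h | h
  · rw [min_eq_left h]
    exact mean_mul_log_two_sub_infoTerm_le_of_le ha h hε
  · rw [min_eq_right h, infoTerm_comm, add_comm a b]
    exact mean_mul_log_two_sub_infoTerm_le_of_le hb h hε

lemma mutualInfo_nonneg {Y : Type} [Fintype Y] {W : ZMod 2 → Y → ℝ}
    (hW : ∀ x y, 0 ≤ W x y) : 0 ≤ mutualInfo W := by
  refine nonneg_of_mul_nonneg_left ?_ (log_pos one_lt_two)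
  rw [mutualInfo_mul_log_two_s12 hW]
  exact Finset.sum_nonneg fun y _ => infoTerm_nonneg (hW 0 y) (hW 1 y)

lemma one_sub_mutualInfo_mul_log_two_le {Y : Type} [Fintype Y] {W : ZMod 2 → Y → ℝ}
    (hW : IsBDMC W) {ε : ℝ} (hε : 0 < ε) :
    (1 - mutualInfo W) * log 2 ≤ ε + (∑ y, min (W 0 y) (W 1 y)) / (2 * ε) := by
  have h := Finset.sum_le_sum fun y (_ : y ∈ Finset.univ) =>
    mean_mul_log_two_sub_infoTerm_le (hW.1 0 y) (hW.1 1 y) hε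
  simp only [Finset.sum_add_distrib, Finset.sum_sub_distrib, ← Finset.mul_sum, ← Finset.sum_mul,
    ← Finset.sum_div, hW.2, ← mutualInfo_mul_log_two_s12 hW.1] at h
  linarith

lemma isBDMC_prodChannel {Y : Type} [Fintype Y] {W : ZMod 2 → Y → ℝ} (hW : IsBDMC W) (k : ℕ) :
    IsBDMC (prodChannel W k) := by
  refine ⟨fun x y => Finset.prod_nonneg fun j _ => hW.1 x (y j), fun x => ?_⟩
  have h := Finset.prod_univ_sum (fun _ : Fin k => (Finset.univ : Finset Y)) fun _ y => W x y
  simp only [hW.2, Finset.prod_const_one, Fintype.piFinset_univ] at h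
  exact h.symm

lemma mutualInfo_add_le_mutualInfo_prodChannel_succ {Y : Type} [Fintype Y]
    {W : ZMod 2 → Y → ℝ} (hW : IsBDMC W) (k : ℕ) :
    mutualInfo W + (∑ y, min (W 0 y) (W 1 y)) * mutualInfo (prodChannel W k)
      ≤ mutualInfo (prodChannel W (k + 1)) := by
  have hV := isBDMC_prodChannel hW k
  refine le_of_mul_le_mul_right ?_ (log_pos one_lt_two)
  rw [add_mul, mul_assoc, mutualInfo_mul_log_two_s12 hW.1, mutualInfo_mul_log_two_s12 hV.1,
    mutualInfo_mul_log_two_s12 (isBDMC_prodChannel hW (k + 1)).1,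
    ← (Fin.consEquiv fun _ : Fin (k + 1) => Y).sum_comp, Fintype.sum_prod_type, Finset.sum_mul,
    ← Finset.sum_add_distrib]
  refine Finset.sum_le_sum fun y _ => ?_
  have h := infoTerm_add_min_mul_le_sum (hV.1 0) (hV.1 1) (hV.2 0) (hV.2 1) (hW.1 0 y) (hW.1 1 y)
  simpa [prodChannel, Fin.prod_univ_succ, Fin.consEquiv] using h

/-- For every `δ > 0` there is `η(δ) > 0` such that every symmetric B-DMC `W`
with `I(W) ∈ (δ, 1-δ)` satisfies `I(W^k) - I(W) > η(δ)` for all `k ≥ 2`. -/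
theorem exists_gain_of_mutualInfo_mem {δ : ℝ} (hδ : 0 < δ) :
    ∃ η : ℝ, 0 < η ∧
      ∀ (Y : Type) [Fintype Y] (W : ZMod 2 → Y → ℝ),
        IsBDMC W → IsSymmetricBDMC W → mutualInfo W ∈ Set.Ioo δ (1 - δ) →
          ∀ k : ℕ, 2 ≤ k → mutualInfo (prodChannel W k) - mutualInfo W > η := by
  have hl : 0 < log 2 := log_pos one_lt_two
  set ε := δ * log 2 / 2 with hεdef
  have hε : 0 < ε := by positivity
  refine ⟨2 * ε ^ 2 * δ, by positivity, fun Y _ W hW _ hI k hk => ?_⟩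
  obtain ⟨m, rfl⟩ := Nat.exists_eq_add_of_le' hk
  set M := ∑ y, min (W 0 y) (W 1 y) with hM
  have hM0 : 0 ≤ M := Finset.sum_nonneg fun y _ => le_min (hW.1 0 y) (hW.1 1 y)
  have hMlt : 2 * ε ^ 2 < M := by
    have h := one_sub_mutualInfo_mul_log_two_le hW hε
    rw [← hM] at h
    have h2 : δ * log 2 < (1 - mutualInfo W) * log 2 :=
      mul_lt_mul_of_pos_right (by linarith [hI.2]) hl
    have h3 : ε < M / (2 * ε) := by linarith
    rw [lt_div_iff₀ (by positivity)] at h3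
    linarith
  have hpow : mutualInfo W ≤ mutualInfo (prodChannel W (m + 1)) :=
    (le_add_of_nonneg_right (mul_nonneg hM0
      (mutualInfo_nonneg (isBDMC_prodChannel hW m).1))).trans
      (mutualInfo_add_le_mutualInfo_prodChannel_succ hW m)
  have hgain := mutualInfo_add_le_mutualInfo_prodChannel_succ hW (m + 1)
  have h4 : 2 * ε ^ 2 * δ < M * mutualInfo (prodChannel W (m + 1)) :=
    mul_lt_mul'' hMlt (hI.1.trans_le hpow) (by positivity) hδ.le
  rw [← hM] at hgain
  rw [gt_iff_lt, lt_sub_iff_add_lt']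
  exact (add_lt_add_right h4 _).trans_le hgain
end
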